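/- arXiv:2111.12975 — 3 statements merged into one kernel-verified Lean document; each statement's English description precedes it below -/
import Mathlib

section
/- For all positive integers k₁,…,k_r, the image of ψ(z_{k₁}⋯z_{k_r}) under the quasisymmetric-function realization Φ equals Σ_{j=1}^{r} k_j (−1)^{r−j+1} Σ_{0<m₁<⋯<m_j, 0<m_r≤m_{r−1}≤⋯≤m_j} t_{m₁}^{k₁}⋯t_{m_r}^{k_r}·t_{m_j}, as formal power series in the variables t₁, t₂, …. -/
open scoped BigOperators

/-- `H¹`: the ℚ-vector space with basis the words `z_{k₁}⋯z_{k_r}` in the letters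
`z_k` (`k` a positive integer), encoded as finitely supported functions on lists. -/
abbrev H1 : Type := List ℕ+ →₀ ℚ

/-- The basis word `z_{k₁}⋯z_{k_r}` of `H¹` (the empty list is the unit `1`). -/
noncomputable def W (l : List ℕ+) : H1 := Finsupp.single l 1

/-- Left multiplication by the letter `z_k` (linear extension of `w ↦ z_k w`). -/
noncomputable def consL (k : ℕ+) (h : H1) : H1 := Finsupp.mapDomain (fun w => k :: w) h

/-- Right multiplication by the letter `z_k` (linear extension of `w ↦ w z_k`). -/
noncomputable def mulRk (k : ℕ+) (h : H1) : H1 := Finsupp.mapDomain (fun w => w ++ [k]) h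

/-- The harmonic (stuffle) product on words:
`1 ∗ u = u ∗ 1 = u`, `z_k u ∗ z_l v = z_k(u ∗ z_l v) + z_l(z_k u ∗ v) + z_{k+l}(u ∗ v)`. -/
noncomputable def harmW : List ℕ+ → List ℕ+ → H1
  | [], v => W v
  | u, [] => W u
  | k :: u, l :: v =>
      consL k (harmW u (l :: v)) + consL l (harmW (k :: u) v) + consL (k + l) (harmW u v)
  termination_by u v => u.length + v.length

/-- The harmonic product `∗` on `H¹`, as the ℚ-bilinear extension of `harmW`. -/
noncomputable def harm (g h : H1) : H1 :=
  g.sum fun u c => h.sum fun v d => (c * d) • harmW u v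

/-- The product `ш̃` on words in the letters `z_k`:
`1 ш̃ u = u ш̃ 1 = u`, `z_k u ш̃ z_l v = z_k(u ш̃ z_l v) + z_l(z_k u ш̃ v)`. -/
noncomputable def shtW : List ℕ+ → List ℕ+ → H1
  | [], v => W v
  | u, [] => W u
  | k :: u, l :: v => consL k (shtW u (l :: v)) + consL l (shtW (k :: u) v)
  termination_by u v => u.length + v.length

/-- The shuffle product `ш̃` on `H¹` (on the alphabet `z₁, z₂, …`), bilinear extension. -/
noncomputable def sht (g h : H1) : H1 :=
  g.sum fun u c => h.sum fun v d => (c * d) • shtW u v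

/-- Addition of a natural number to a positive natural number. -/
def pplus (k : ℕ+) (e : ℕ) : ℕ+ := ⟨(k : ℕ) + e, by have := k.pos; omega⟩

/-- `σ_m` on words: `σ_m(z_{k₁}⋯z_{k_r}) = Σ_{e₁+⋯+e_r=m} ∏_j C(k_j+e_j-1, e_j) z_{k₁+e₁}⋯z_{k_r+e_r}`,
which is the word formula for `σ_m(1) = δ_{m,0}`, `σ_m(yw) = y(w ш x^m)`. -/
noncomputable def sigW : ℕ → List ℕ+ → H1
  | m, [] => if m = 0 then W [] else 0
  | m, k :: ks => ∑ e ∈ Finset.range (m + 1),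
      ((((k : ℕ) + e - 1).choose e : ℚ)) • consL (pplus k e) (sigW (m - e) ks)
  termination_by m ks => ks.length

/-- `σ_m : H¹ → H¹`, linear extension. -/
noncomputable def sig (m : ℕ) (h : H1) : H1 := h.sum fun ks c => c • sigW m ks

/-- `S` on words: the word formula for `S(1) = 1`, `S(yw) = y S₁(w)` where
`S₁(x) = x`, `S₁(y) = x + y`; explicitly `S(z_{k₁}⋯z_{k_r})` is the sum over all ways of
replacing separating commas by `+`. -/
noncomputable def StW : List ℕ+ → H1
  | [] => W []
  | [k] => W [k]
  | k :: l :: ks => consL k (StW (l :: ks)) + StW ((k + l) :: ks)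
  termination_by ks => ks.length

/-- `S : H¹ → H¹`, linear extension. -/
noncomputable def St (h : H1) : H1 := h.sum fun ks c => c • StW ks

/-- `S̃ = S ∘ d` on words, where `d(x) = x`, `d(y) = -y`, so `d` multiplies a word of
depth `r` by `(-1)^r`. -/
noncomputable def SttW (ks : List ℕ+) : H1 := ((-1 : ℚ)) ^ ks.length • StW ks

/-- `S̃ = S ∘ d : H¹ → H¹`, linear extension. -/
noncomputable def Stt (h : H1) : H1 := h.sum fun ks c => c • SttW ks

/-- `ψ` on words: `ψ(z_{k₁}⋯z_{k_r}) = Σ_{i=0}^{r-1} z_{k₁}⋯z_{k_i} ∗ S̃(σ₁(z_{k_r}⋯z_{k_{i+1}}))`. -/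
noncomputable def psiW (ks : List ℕ+) : H1 :=
  ∑ i ∈ Finset.range ks.length, harm (W (ks.take i)) (Stt (sigW 1 ((ks.drop i).reverse)))

/-- `ψ : yH → H¹`, linear extension. -/
noncomputable def psi (h : H1) : H1 := h.sum fun ks c => c • psiW ks

/-- `ψ̄` on words: `ψ̄(z_{k₁}⋯z_{k_r}) = Σ_{i=0}^{r-1} (-1)^{r-i} z_{k₁}⋯z_{k_i} ш̃ σ₁(z_{k_r}⋯z_{k_{i+1}})`. -/
noncomputable def psibW (ks : List ℕ+) : H1 :=
  ∑ i ∈ Finset.range ks.length,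
    ((-1 : ℚ)) ^ (ks.length - i) • sht (W (ks.take i)) (sigW 1 ((ks.drop i).reverse))

/-- `ψ̄ : yH → H¹`, linear extension. -/
noncomputable def psib (h : H1) : H1 := h.sum fun ks c => c • psibW ks

/-- `ρ` on words:
`ρ(z_{k₁}⋯z_{k_r}) = Σ_{i=1}^{r} (-1)^{r-i} (z_{k₁}⋯z_{k_{i-1}} ш̃ z_{k_r}⋯z_{k_{i+1}}) z_{k_i}`. -/
noncomputable def rhoW (ks : List ℕ+) : H1 :=
  ∑ i : Fin ks.length, ((-1 : ℚ)) ^ (ks.length - 1 - (i : ℕ)) •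
    mulRk (ks.get i) (sht (W (ks.take (i : ℕ))) (W ((ks.drop ((i : ℕ) + 1)).reverse)))

/-- `ρ : yH → yH`, linear extension. -/
noncomputable def rho (h : H1) : H1 := h.sum fun ks c => c • rhoW ks

/-- `yH ⊆ H¹`: the span of the nonempty words `z_{k₁}⋯z_{k_r}` (`r ≥ 1`). -/
noncomputable def yH1 : Submodule ℚ H1 := Submodule.span ℚ {h | ∃ k ks, h = W (k :: ks)}

/-- `yH ∗ yH`: the ℚ-span of the harmonic products `w₁ ∗ w₂` with `w₁, w₂ ∈ yH`. -/
noncomputable def harmSpan : Submodule ℚ H1 :=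
  Submodule.span ℚ {h | ∃ u ∈ yH1, ∃ v ∈ yH1, h = harm u v}

/-- `yH ш̃ yH`: the ℚ-span of the products `w₁ ш̃ w₂` with `w₁, w₂ ∈ yH`. -/
noncomputable def shtSpan : Submodule ℚ H1 :=
  Submodule.span ℚ {h | ∃ u ∈ yH1, ∃ v ∈ yH1, h = sht u v}
/-- The ring of formal power series in the commuting variables `t₁, t₂, …`
(containing the quasisymmetric functions). -/
abbrev QS : Type := MvPowerSeries ℕ+ ℚ

/-- A (possibly infinite) sum of formal power series, computed coefficientwise. -/
noncomputable def msum {ι : Type} (F : ι → QS) : QS :=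
  fun d => ∑' i, F i d

/-- `Φ` on words: `Φ(z_{k₁}⋯z_{k_r}) = Σ_{0<m₁<⋯<m_r} t_{m₁}^{k₁}⋯t_{m_r}^{k_r}`. -/
noncomputable def PhiW (ks : List ℕ+) : QS :=
  msum fun m : {f : Fin ks.length → ℕ+ // StrictMono f} =>
    ∏ j : Fin ks.length, (MvPowerSeries.X (m.1 j)) ^ ((ks.get j : ℕ))

/-- The quasisymmetric realization `Φ : H¹ → QSym`, linear extension. -/
noncomputable def Phi (h : H1) : QS := h.sum fun ks c => c • PhiW ks


section PhiPsiAux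

set_option linter.unusedSectionVars false

variable {R : Type} [CommRing R] [Algebra ℚ R]

/-- Linear extension of a function on words. -/
noncomputable def lc {M : Type} [AddCommGroup M] [Module ℚ M] (φ : List ℕ+ → M) : H1 →ₗ[ℚ] M :=
  Finsupp.linearCombination ℚ φ

theorem lc_W {M : Type} [AddCommGroup M] [Module ℚ M] (φ : List ℕ+ → M) (w : List ℕ+) :
    lc φ (W w) = φ w := by
  simp [lc, W]

theorem lc_consL {M : Type} [AddCommGroup M] [Module ℚ M] (φ : List ℕ+ → M) (k : ℕ+) (h : H1) :
    lc φ (consL k h) = lc (fun w => φ (k :: w)) h := by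
  simp only [lc, consL]
  rw [Finsupp.linearCombination_mapDomain]
  rfl

theorem lc_add_fun {M : Type} [AddCommGroup M] [Module ℚ M] (φ χ : List ℕ+ → M) (h : H1) :
    lc (fun w => φ w + χ w) h = lc φ h + lc χ h := by
  simp [lc, Finsupp.linearCombination_apply, smul_add, Finsupp.sum_add]

theorem lc_mul_fun (c : R) (φ : List ℕ+ → R) (h : H1) :
    lc (fun w => c * φ w) h = c * lc φ h := by
  simp [lc, Finsupp.linearCombination_apply, Finsupp.mul_sum]

/-- Truncated strict quasisymmetric sums. -/
def FF (X : ℕ+ → R) : List ℕ+ → List ℕ+ → R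
  | _, [] => 1
  | [], _ :: _ => 0
  | t :: L, k :: ks => X t ^ (k : ℕ) * FF X L ks + FF X L (k :: ks)

/-- Truncated weak quasisymmetric sums, with sign. -/
def GG (X : ℕ+ → R) : List ℕ+ → List ℕ+ → R
  | _, [] => 1
  | [], _ :: _ => 0
  | t :: L, k :: ks => - (X t ^ (k : ℕ) * GG X (t :: L) ks) + GG X L (k :: ks)
  termination_by L ks => L.length + ks.length

theorem FF_nil (X : ℕ+ → R) (L : List ℕ+) : FF X L [] = 1 := by cases L <;> simp [FF]
theorem GG_nil (X : ℕ+ → R) (L : List ℕ+) : GG X L [] = 1 := by cases L <;> simp [GG]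

theorem FF_cons (X : ℕ+ → R) (t : ℕ+) (L : List ℕ+) (k : ℕ+) (h : H1) :
    lc (FF X (t :: L)) (consL k h) = X t ^ (k : ℕ) * lc (FF X L) h + lc (FF X L) (consL k h) := by
  rw [lc_consL, lc_consL, ← lc_mul_fun, ← lc_add_fun]
  congr 1

theorem FF_cons_nil (X : ℕ+ → R) (k : ℕ+) (h : H1) :
    lc (FF X []) (consL k h) = 0 := by
  rw [lc_consL]
  simp [lc, Finsupp.linearCombination_apply, FF]

theorem GG_cons (X : ℕ+ → R) (t : ℕ+) (L : List ℕ+) (k : ℕ+) (h : H1) :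
    lc (GG X (t :: L)) (consL k h) =
      - (X t ^ (k : ℕ) * lc (GG X (t :: L)) h) + lc (GG X L) (consL k h) := by
  rw [lc_consL, lc_consL, ← neg_mul, ← lc_mul_fun, ← lc_add_fun]
  congr 2
  funext w
  rw [GG, neg_mul]

theorem GG_cons_nil (X : ℕ+ → R) (k : ℕ+) (h : H1) :
    lc (GG X []) (consL k h) = 0 := by
  rw [lc_consL]
  simp [lc, Finsupp.linearCombination_apply, GG]

theorem FF_harmW (X : ℕ+ → R) (L : List ℕ+) : ∀ u v : List ℕ+,
    lc (FF X L) (harmW u v) = FF X L u * FF X L v := by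
  induction L with
  | nil =>
    intro u v
    cases u with
    | nil => simp [harmW, lc_W, FF]
    | cons k u =>
      cases v with
      | nil => simp [harmW, lc_W, FF]
      | cons l v => simp [harmW, FF_cons_nil, FF]
  | cons t L ih =>
    intro u v
    cases u with
    | nil => simp [harmW, lc_W, FF]
    | cons k u =>
      cases v with
      | nil => simp [harmW, lc_W, FF]
      | cons l v =>
        have h := ih (k :: u) (l :: v)
        rw [harmW, map_add, map_add] at h
        rw [harmW, map_add, map_add, FF_cons, FF_cons, FF_cons, ih, ih, ih, FF, FF]
        rw [PNat.add_coe, pow_add]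
        linear_combination h

theorem FF_harm (X : ℕ+ → R) (L : List ℕ+) (u : List ℕ+) (h : H1) :
    lc (FF X L) (harm (W u) h) = FF X L u * lc (FF X L) h := by
  rw [← lc_mul_fun]
  simp [harm, W, lc, Finsupp.linearCombination_apply, Finsupp.sum_single_index]
  have := FF_harmW X L u
  simp [lc] at this
  rw [← Finsupp.linearCombination_apply]
  rw [Finsupp.sum, map_sum, Finsupp.sum]
  refine Finset.sum_congr rfl fun v _ => ?_
  rw [map_smul, this]

theorem FF_SttW (X : ℕ+ → R) : ∀ (n : ℕ) (ks : List ℕ+) (L : List ℕ+), ks.length + L.length = n →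
    lc (FF X L) (SttW ks) = GG X L ks := by
  intro n
  induction n using Nat.strong_induction_on with
  | _ n ih =>
    intro ks L hn
    have ih' : ∀ ks' L' : List ℕ+, ks'.length + L'.length < ks.length + L.length →
        lc (FF X L') (SttW ks') = GG X L' ks' := fun ks' L' h => ih _ (hn ▸ h) ks' L' rfl
    clear ih
    match ks, L with
    | [], L => simp [SttW, StW, lc_W, FF_nil, GG_nil]
    | [k], [] => simp [SttW, StW, lc_W, FF, GG]
    | [k], t :: L =>
      have := ih' [k] L (by simp)
      simp only [SttW, StW, map_smul, lc_W, FF, GG, List.length_singleton, FF_nil] at this ⊢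
      rw [← this]
      simp
    | k :: l :: ks, [] =>
      have := ih' ((k + l) :: ks) [] (by simp)
      simp only [SttW, StW, map_smul, map_add, FF_cons_nil, GG, List.length_cons, zero_add] at this ⊢
      rw [pow_succ, mul_smul, smul_comm, this, smul_zero]
    | k :: l :: ks, t :: L =>
      have h1 := ih' ((k + l) :: ks) (t :: L) (by simp)
      have h2 := ih' ((k + l) :: ks) L (by simp; omega)
      have h3 := ih' (k :: l :: ks) L (by simp)
      have h4 := ih' (l :: ks) L (by simp; omega)
      simp only [SttW, StW, map_smul, map_add, FF_cons, GG, List.length_cons] at h1 h2 h3 h4 ⊢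
      simp only [Algebra.smul_def, map_mul, map_pow, map_neg, map_one, PNat.add_coe, pow_add] at h1 h2 h3 h4 ⊢
      linear_combination -h1 + h2 + h3 - X t ^ (k : ℕ) * h4

theorem FF_Stt (X : ℕ+ → R) (L : List ℕ+) (h : H1) :
    lc (FF X L) (Stt h) = lc (GG X L) h := by
  simp only [Stt]
  rw [Finsupp.sum, map_sum]
  conv_rhs => rw [lc, Finsupp.linearCombination_apply, Finsupp.sum]
  refine Finset.sum_congr rfl fun v _ => ?_
  rw [map_smul, FF_SttW X _ v L rfl]

theorem sigW_zero (ks : List ℕ+) : sigW 0 ks = W ks := by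
  induction ks with
  | nil => simp [sigW]
  | cons k ks ih =>
    have : pplus k 0 = k := by apply PNat.eq; simp [pplus]
    simp [sigW, ih, this, consL, W]

theorem sigW_one_cons (k : ℕ+) (ks : List ℕ+) :
    sigW 1 (k :: ks) = consL k (sigW 1 ks) + ((k : ℕ) : ℚ) • W ((k + 1) :: ks) := by
  have h0 : pplus k 0 = k := by apply PNat.eq; simp [pplus]
  have h1 : pplus k 1 = k + 1 := by apply PNat.eq; simp [pplus]
  simp [sigW, Finset.sum_range_succ, h0, h1, sigW_zero]
  simp [consL, W]

/-- Sums over lists of length `n` with entries from `L`. -/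
def LS (L : List ℕ+) : ℕ → (List ℕ+ → R) → R
  | 0, g => g []
  | n + 1, g => (L.map fun m => LS L n fun l => g (m :: l)).sum

theorem LS_congr (L : List ℕ+) : ∀ (n : ℕ) (g g' : List ℕ+ → R),
    (∀ l, l.length = n → (∀ x ∈ l, x ∈ L) → g l = g' l) → LS L n g = LS L n g'
  | 0, g, g', h => h [] rfl (by simp)
  | n + 1, g, g', h => by
    simp only [LS]
    congr 1
    refine List.map_congr_left fun m hm => ?_
    refine LS_congr L n _ _ fun l hl hx => h _ (by simp [hl]) ?_
    simpa [hm] using hx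

theorem LS_zero (L : List ℕ+) : ∀ (n : ℕ), LS L n (fun _ => (0 : R)) = 0
  | 0 => rfl
  | n + 1 => by simp [LS, LS_zero L n]

theorem LS_add (L : List ℕ+) : ∀ (n : ℕ) (g g' : List ℕ+ → R),
    LS L n (fun l => g l + g' l) = LS L n g + LS L n g'
  | 0, g, g' => rfl
  | n + 1, g, g' => by simp [LS, LS_add L n, List.sum_map_add]

theorem LS_mul (L : List ℕ+) (c : R) : ∀ (n : ℕ) (g : List ℕ+ → R),
    LS L n (fun l => c * g l) = c * LS L n g
  | 0, g => rfl
  | n + 1, g => by simp [LS, LS_mul L c n, List.sum_map_mul_left]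

theorem LS_sum {ι : Type} (s : Finset ι) (L : List ℕ+) (n : ℕ) (g : ι → List ℕ+ → R) :
    LS L n (fun l => ∑ i ∈ s, g i l) = ∑ i ∈ s, LS L n (g i) := by
  classical
  induction s using Finset.induction_on with
  | empty => simp [LS_zero]
  | insert a s ha ih => simp [Finset.sum_insert ha, LS_add, ih]

theorem LS_append (L : List ℕ+) (b : ℕ) : ∀ (a : ℕ) (g : List ℕ+ → R),
    LS L (a + b) g = LS L a fun u => LS L b fun v => g (u ++ v)
  | 0, g => by simp [LS]
  | a + 1, g => by
    rw [Nat.succ_add]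
    simp [LS, LS_append L b a]

theorem LS_swap (L : List ℕ+) (g : ℕ+ → List ℕ+ → R) (n : ℕ) (L' : List ℕ+) :
    LS L n (fun l => (L'.map fun m => g m l).sum) = (L'.map fun m => LS L n (g m)).sum := by
  induction L' with
  | nil => simp [LS_zero]
  | cons a L' ih => simp [LS_add, ih]

theorem LS_reverse (L : List ℕ+) : ∀ (n : ℕ) (g : List ℕ+ → R),
    LS L n (fun l => g l.reverse) = LS L n g
  | 0, g => by simp [LS]
  | n + 1, g => by
    conv_rhs => rw [LS_append L 1 n]
    simp only [LS, List.reverse_cons]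
    rw [LS_swap]
    congr 1
    refine List.map_congr_left fun m _ => ?_
    exact LS_reverse L n fun l => g (l ++ [m])

theorem LS_drop (t : ℕ+) (L : List ℕ+) : ∀ (n : ℕ) (g : List ℕ+ → R),
    (∀ l, t ∈ l → g l = 0) → LS (t :: L) n g = LS L n g
  | 0, g, h => rfl
  | n + 1, g, h => by
    simp only [LS, List.map_cons, List.sum_cons]
    have : (fun l => g (t :: l)) = fun _ => 0 := by
      funext l; exact h _ (by simp)
    rw [this, LS_zero, zero_add]
    congr 1
    refine List.map_congr_left fun m _ => ?_
    exact LS_drop t L n _ fun l hl => h _ (by simp [hl])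

open Classical in
theorem LS_strict (t : ℕ+) (L : List ℕ+) (hL : (t :: L).Pairwise (· < ·)) (n : ℕ)
    (g : List ℕ+ → R) :
    LS (t :: L) (n + 1) (fun l => if l.Pairwise (· < ·) then g l else 0) =
      LS L n (fun l => if l.Pairwise (· < ·) then g (t :: l) else 0) +
      LS L (n + 1) (fun l => if l.Pairwise (· < ·) then g l else 0) := by
  rw [List.pairwise_cons] at hL
  rw [LS, List.map_cons, List.sum_cons, LS_drop]
  · congr 1
    · refine LS_congr _ _ _ _ fun l _ hl => ?_
      have : ∀ a' ∈ l, t < a' := fun a ha => hL.1 a (hl a ha)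
      have hp : (t :: l).Pairwise (· < ·) ↔ l.Pairwise (· < ·) :=
        List.pairwise_cons.trans (and_iff_right this)
      simp only [hp]
    · rw [LS]
      congr 1
      refine List.map_congr_left fun m hm => ?_
      refine LS_drop _ _ _ _ fun l hl => ?_
      rw [if_neg]
      intro h
      rw [List.pairwise_cons] at h
      exact absurd (h.1 t hl) (not_lt.2 (hL.1 m hm).le)
  · intro l hl
    rw [if_neg]
    intro h
    rw [List.pairwise_cons] at h
    exact absurd (h.1 t hl) (lt_irrefl _)

open Classical in
theorem LS_weak (t : ℕ+) (L : List ℕ+) (hL : (t :: L).Pairwise (· < ·)) (n : ℕ)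
    (g : List ℕ+ → R) :
    LS (t :: L) (n + 1) (fun l => if l.Pairwise (· ≤ ·) then g l else 0) =
      LS (t :: L) n (fun l => if l.Pairwise (· ≤ ·) then g (t :: l) else 0) +
      LS L (n + 1) (fun l => if l.Pairwise (· ≤ ·) then g l else 0) := by
  rw [List.pairwise_cons] at hL
  rw [LS, List.map_cons, List.sum_cons]
  congr 1
  · refine LS_congr _ _ _ _ fun l _ hl => ?_
    have : ∀ a' ∈ l, t ≤ a' := fun a ha => by
      rcases List.mem_cons.1 (hl a ha) with h | h
      · exact h.ge
      · exact (hL.1 a h).le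
    have hp : (t :: l).Pairwise (· ≤ ·) ↔ l.Pairwise (· ≤ ·) :=
      List.pairwise_cons.trans (and_iff_right this)
    simp only [hp]
  · rw [LS]
    congr 1
    refine List.map_congr_left fun m hm => ?_
    refine LS_drop _ _ _ _ fun l hl => ?_
    rw [if_neg]
    intro h
    rw [List.pairwise_cons] at h
    exact absurd (h.1 t hl) (not_le.2 (hL.1 m hm))

/-- The monomial attached to exponents `ks` and indices `ms`. -/
def wt (X : ℕ+ → R) (ks ms : List ℕ+) : R :=
  (List.zipWith (fun (k m : ℕ+) => X m ^ (k : ℕ)) ks ms).prod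

/-- The linear form `∑ k_j X_{m_j}`. -/
def ln (X : ℕ+ → R) (ks ms : List ℕ+) : R :=
  (List.zipWith (fun (k m : ℕ+) => ((k : ℕ) : R) * X m) ks ms).sum

open Classical in
theorem FF_eq_LS (X : ℕ+ → R) (L : List ℕ+) : L.Pairwise (· < ·) → ∀ ks : List ℕ+,
    FF X L ks = LS L ks.length (fun l => if l.Pairwise (· < ·) then wt X ks l else 0) := by
  induction L with
  | nil => intro _ ks; cases ks <;> simp [FF, LS, wt]
  | cons t L ih =>
    intro hL ks
    cases ks with
    | nil => simp [FF, LS, wt]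
    | cons k ks =>
      have h' := (List.pairwise_cons.1 hL).2
      rw [FF, List.length_cons, LS_strict t L hL, ih h', ih h', ← LS_mul]
      simp [wt]

open Classical in
theorem GG_eq_LS (X : ℕ+ → R) (L : List ℕ+) : L.Pairwise (· < ·) → ∀ ks : List ℕ+,
    GG X L ks = (-1) ^ ks.length *
      LS L ks.length (fun l => if l.Pairwise (· ≤ ·) then wt X ks l else 0) := by
  induction L with
  | nil => intro _ ks; cases ks <;> simp [GG, LS, wt]
  | cons t L ih =>
    intro hL ks
    induction ks with
    | nil => simp [GG, LS, wt]
    | cons k ks ihk =>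
      have h' := (List.pairwise_cons.1 hL).2
      have e : LS (t :: L) ks.length (fun l => if l.Pairwise (· ≤ ·) then wt X (k :: ks) (t :: l) else 0)
        = X t ^ (k : ℕ) * LS (t :: L) ks.length (fun l => if l.Pairwise (· ≤ ·) then wt X ks l else 0) := by
        rw [← LS_mul]; simp [wt]
      rw [GG, List.length_cons, LS_weak t L hL, ih h', ihk, e, List.length_cons]
      ring

open Classical in
theorem GG_sigW (X : ℕ+ → R) (L : List ℕ+) : L.Pairwise (· < ·) → ∀ ks : List ℕ+,
    lc (GG X L) (sigW 1 ks) = (-1) ^ ks.length *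
      LS L ks.length (fun l => if l.Pairwise (· ≤ ·) then wt X ks l * ln X ks l else 0) := by
  induction L with
  | nil =>
    intro _ ks
    cases ks
    · simp [sigW, LS, ln]
    · simp [sigW_one_cons, GG_cons_nil, lc_W, GG, LS]
  | cons t L ih =>
    intro hL ks
    induction ks with
    | nil => simp [sigW, LS, ln]
    | cons k ks ihk =>
      have h' := (List.pairwise_cons.1 hL).2
      have e : LS (t :: L) ks.length (fun l => if l.Pairwise (· ≤ ·) then
            wt X (k :: ks) (t :: l) * ln X (k :: ks) (t :: l) else 0)
        = X t ^ (k : ℕ) *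
            LS (t :: L) ks.length (fun l => if l.Pairwise (· ≤ ·) then wt X ks l * ln X ks l else 0)
          + (k : ℕ) * X t ^ (k + 1 : ℕ) * LS (t :: L) ks.length
            (fun l => if l.Pairwise (· ≤ ·) then wt X ks l else 0) := by
        rw [← LS_mul, ← LS_mul, ← LS_add]
        congr 1
        funext l
        split_ifs
        · simp [wt, ln]; ring
        · simp
      have i1 := ih h' (k :: ks)
      rw [sigW_one_cons, map_add, map_smul, lc_W] at i1
      rw [sigW_one_cons, map_add, GG_cons, ihk, map_smul, lc_W, GG, List.length_cons, LS_weak t L hL,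
        e, GG_eq_LS X _ hL ks]
      rw [List.length_cons] at i1
      simp only [Algebra.smul_def, map_natCast, PNat.add_coe, PNat.one_coe] at i1 ⊢
      linear_combination i1

theorem LS_prod (L : List ℕ+) (a b : ℕ) (g g' : List ℕ+ → R) :
    LS L a g * LS L b g' = LS L (a + b) (fun ms => g (ms.take a) * g' (ms.drop a)) := by
  rw [LS_append, mul_comm, ← LS_mul]
  refine LS_congr _ _ _ _ fun u hu _ => ?_
  rw [mul_comm, ← LS_mul]
  refine LS_congr _ _ _ _ fun v _ _ => ?_
  simp [← hu]

theorem wt_take_drop (X : ℕ+ → R) (ks ms : List ℕ+) (i : ℕ) :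
    wt X (ks.take i) (ms.take i) * wt X (ks.drop i) (ms.drop i) = wt X ks ms := by
  rw [wt, wt, wt, ← List.take_zipWith, ← List.drop_zipWith, List.prod_take_mul_prod_drop]

theorem wt_reverse (X : ℕ+ → R) (ks ms : List ℕ+) (h : ks.length = ms.length) :
    wt X ks.reverse ms.reverse = wt X ks ms := by
  rw [wt, wt, ← List.reverse_zipWith h, List.prod_reverse]

theorem ln_reverse (X : ℕ+ → R) (ks ms : List ℕ+) (h : ks.length = ms.length) :
    ln X ks.reverse ms.reverse = ln X ks ms := by
  rw [ln, ln, ← List.reverse_zipWith h, List.sum_reverse]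

theorem telescope (r : ℕ) (A B D c : ℕ → R) (h0 : A 0 = B 0)
    (hA : ∀ n, n + 1 < r → A (n + 1) = B n + B (n + 1))
    (hD : ∀ n, n < r → D n = c n + D (n + 1)) (hr : D r = 0) :
    ∑ i ∈ Finset.range r, (-1) ^ (r - i) * (A i * D i) =
      ∑ i ∈ Finset.range r, (-1) ^ (r - i) * (B i * c i) := by
  have key : ∀ n, n + 1 ≤ r → ∑ i ∈ Finset.range (n + 1), (-1) ^ (r - i) * (A i * D i) =
      ∑ i ∈ Finset.range (n + 1), (-1) ^ (r - i) * (B i * c i) +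
        (-1) ^ (r - n) * (B n * D (n + 1)) := by
    intro n
    induction n with
    | zero =>
      intro h
      simp only [zero_add, Finset.sum_range_one, h0, hD 0 (by omega)]
      ring
    | succ n ih =>
      intro h
      rw [Finset.sum_range_succ, ih (by omega), Finset.sum_range_succ _ (n + 1), hA n (by omega),
        hD (n + 1) (by omega), show r - n = r - (n + 1) + 1 by omega]
      ring
  cases r with
  | zero => simp
  | succ n => rw [key n le_rfl, hr]; simp

/-- strictly increasing on the first `i` entries, weakly decreasing from index `i` on. -/
def PA (i : ℕ) (ms : List ℕ+) : Prop :=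
  (ms.take i).Pairwise (· < ·) ∧ (ms.drop i).Pairwise (· ≥ ·)

/-- strictly increasing on the entries up to `j`, weakly decreasing from `j` on. -/
def PB (j : ℕ) (ms : List ℕ+) : Prop :=
  (ms.take (j + 1)).Pairwise (· < ·) ∧ (ms.drop j).Pairwise (· ≥ ·)

theorem PA_zero (ms : List ℕ+) : PA 0 ms ↔ PB 0 ms := by
  cases ms <;> simp [PA, PB]

theorem take_pw (i : ℕ) (ms : List ℕ+) : (ms.take i).Pairwise (· < ·) ↔
    ∀ a b, ∀ (hb : b < ms.length) (hab : a < b), b < i → ms[a] < ms[b] := by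
  rw [List.pairwise_iff_getElem]
  simp only [List.length_take, List.getElem_take]
  constructor
  · intro h a b hb hab hi
    exact h a b (by omega) (by omega) hab
  · intro h a b ha hb hab
    exact h a b (by omega) hab (by omega)

theorem drop_pw (i : ℕ) (ms : List ℕ+) : (ms.drop i).Pairwise (· ≥ ·) ↔
    ∀ a b, ∀ (hb : b < ms.length) (hab : a < b), i ≤ a → ms[b] ≤ ms[a] := by
  rw [List.pairwise_iff_getElem]
  simp only [List.length_drop, List.getElem_drop]
  constructor
  · intro h a b hb hab hi
    have := h (a - i) (b - i) (by omega) (by omega) (by omega)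
    simpa [show i + (a - i) = a by omega, show i + (b - i) = b by omega] using this
  · intro h a b ha hb hab
    exact h (i + a) (i + b) (by omega) (by omega) (by omega)

theorem PA_succ_of_lt (n : ℕ) (ms : List ℕ+) (hn : n + 1 < ms.length) (h : ms[n] < ms[n + 1]) :
    (PA (n + 1) ms ↔ PB (n + 1) ms) ∧ ¬ PB n ms := by
  simp only [PA, PB, take_pw, drop_pw]
  refine ⟨⟨fun ⟨h1, h2⟩ => ⟨?_, h2⟩, fun ⟨h1, h2⟩ => ⟨?_, h2⟩⟩, fun ⟨h1, h2⟩ => ?_⟩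
  · intro a b hb hab hb'
    rcases Nat.lt_or_ge b (n + 1) with hh | hh
    · exact h1 a b hb hab hh
    · obtain rfl : b = n + 1 := by omega
      rcases Nat.lt_or_ge a n with ha | ha
      · exact (h1 a n (by omega) ha (by omega)).trans h
      · obtain rfl : a = n := by omega
        exact h
  · intro a b hb hab hb'
    exact h1 a b hb hab (by omega)
  · exact absurd (h2 n (n + 1) hn (by omega) le_rfl) (not_le.2 h)

theorem PA_succ_of_ge (n : ℕ) (ms : List ℕ+) (hn : n + 1 < ms.length) (h : ms[n + 1] ≤ ms[n]) :
    (PA (n + 1) ms ↔ PB n ms) ∧ ¬ PB (n + 1) ms := by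
  simp only [PA, PB, take_pw, drop_pw]
  refine ⟨⟨fun ⟨h1, h2⟩ => ⟨h1, ?_⟩, fun ⟨h1, h2⟩ => ⟨h1, ?_⟩⟩, fun ⟨h1, h2⟩ => ?_⟩
  · intro a b hb hab ha
    rcases Nat.lt_or_ge n a with hh | hh
    · exact h2 a b hb hab hh
    · obtain rfl : a = n := by omega
      rcases Nat.lt_or_ge (a + 1) b with hb' | hb'
      · exact (h2 (a + 1) b hb hb' le_rfl).trans h
      · obtain rfl : b = a + 1 := by omega
        exact h
  · intro a b hb hab ha
    exact h2 a b hb hab (by omega)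
  · exact absurd (h1 n (n + 1) hn (by omega) (by omega)) (not_lt.2 h)

open Classical in
theorem pointwise (X : ℕ+ → R) (ks ms : List ℕ+) (h : ms.length = ks.length) :
    ∑ i ∈ Finset.range ks.length, (-1) ^ (ks.length - i) *
        (if PA i ms then wt X ks ms * ln X (ks.drop i) (ms.drop i) else 0) =
      ∑ j : Fin ks.length, (((ks.get j : ℕ) : R) * (-1) ^ (ks.length - (j : ℕ))) *
        (if PB j ms then wt X ks ms * X (ms.getD j 1) else 0) := by
  have := telescope ks.length (fun i => if PA i ms then wt X ks ms else 0)
    (fun i => if PB i ms then wt X ks ms else 0) (fun i => ln X (ks.drop i) (ms.drop i))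
    (fun i => ((ks.getD i 1 : ℕ) : R) * X (ms.getD i 1)) (by simp only [PA_zero]) ?_ ?_ ?_
  · rw [Finset.sum_range (n := ks.length) (f := fun i => (-1) ^ (ks.length - i) *
      ((if PB i ms then wt X ks ms else 0) * (((ks.getD i 1 : ℕ) : R) * X (ms.getD i 1))))] at this
    simp only [ite_mul, zero_mul] at this
    rw [this]
    refine Finset.sum_congr rfl fun j _ => ?_
    have e : ks.getD j 1 = ks.get j := by simp
    rw [e]
    split_ifs
    · ring
    · simp
  · intro n hn
    rcases lt_or_ge ms[n] ms[n + 1] with hh | hh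
    · obtain ⟨h1, h2⟩ := PA_succ_of_lt n ms (by omega) hh
      simp [h1, h2]
    · obtain ⟨h1, h2⟩ := PA_succ_of_ge n ms (by omega) hh
      simp [h1, h2]
  · intro n hn
    have hm : n < ms.length := by omega
    simp only [ln]
    rw [List.drop_eq_getElem_cons hn, List.drop_eq_getElem_cons hm, List.zipWith_cons_cons,
      List.sum_cons, List.getD_eq_getElem _ _ hn, List.getD_eq_getElem _ _ hm]
  · simp [ln]

open Classical in
theorem FF_psi (X : ℕ+ → R) (L : List ℕ+) (hL : L.Pairwise (· < ·)) (ks : List ℕ+) :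
    lc (FF X L) (psiW ks) =
      ∑ j : Fin ks.length, (((ks.get j : ℕ) : R) * (-1) ^ (ks.length - (j : ℕ))) *
        LS L ks.length (fun ms => if PB j ms then wt X ks ms * X (ms.getD j 1) else 0) := by
  simp only [← LS_mul]
  rw [← LS_sum, ← LS_congr _ _ _ _ (fun ms h _ => pointwise X ks ms h), LS_sum, psiW, map_sum]
  refine Finset.sum_congr rfl fun i hi => ?_
  have hi := Finset.mem_range.1 hi
  rw [FF_harm, FF_Stt, GG_sigW X L hL, FF_eq_LS X L hL, LS_mul, mul_left_comm]
  rw [← LS_reverse L (List.length (List.reverse _)), LS_prod]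
  simp only [List.length_take, List.length_reverse, List.length_drop]
  congr 1
  rw [min_eq_left hi.le, Nat.add_sub_cancel' hi.le]
  refine LS_congr _ _ _ _ fun ms hms _ => ?_
  have hl : (ks.drop i).length = (ms.drop i).length := by simp [hms]
  rw [wt_reverse X _ _ hl, ln_reverse X _ _ hl, ← wt_take_drop X ks ms i]
  simp only [PA, ge_iff_le, List.pairwise_reverse]
  by_cases h1 : (ms.take i).Pairwise (· < ·) <;>
    by_cases h2 : (ms.drop i).Pairwise (fun a b => b ≤ a) <;> simp [h1, h2, mul_assoc]

theorem LS_eq_sum (s : Finset ℕ+) : ∀ (n : ℕ) (g : List ℕ+ → R),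
    LS (s.sort (· ≤ ·)) n g = ∑ f ∈ Fintype.piFinset (fun _ : Fin n => s), g (List.ofFn f)
  | 0, g => by simp [LS]
  | n + 1, g => by
    rw [LS]
    simp only [LS_eq_sum s n]
    have e : ∀ φ : ℕ+ → R, ((s.sort (· ≤ ·)).map φ).sum = ∑ m ∈ s, φ m := by
      intro φ
      rw [← List.sum_toFinset _ (Finset.sort_nodup _ _), Finset.sort_toFinset]
    rw [e, ← Finset.sum_product']
    refine Finset.sum_nbij' (fun p => (Fin.cons p.1 p.2 : Fin (n + 1) → ℕ+))
      (fun f => (f 0, Fin.tail f)) ?_ ?_ ?_ ?_ ?_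
    · rintro ⟨a, f⟩ h
      simp only [Finset.mem_product, Fintype.mem_piFinset] at h ⊢
      intro i
      refine Fin.cases ?_ (fun i => ?_) i
      · simpa using h.1
      · simpa using h.2 i
    · intro f h
      simp only [Finset.mem_product, Fintype.mem_piFinset] at h ⊢
      exact ⟨h 0, fun i => h i.succ⟩
    · rintro ⟨a, f⟩ _
      simp
    · intro f _
      simp
    · rintro ⟨a, f⟩ _
      simp [List.ofFn_succ]

theorem msum_coeff (d : ℕ+ →₀ ℕ) (n : ℕ) (P : (Fin n → ℕ+) → Prop) (Q : List ℕ+ → Prop) [DecidablePred Q]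
    (hPQ : ∀ f, P f ↔ Q (List.ofFn f)) (G : (Fin n → ℕ+) → QS) (F : List ℕ+ → QS)
    (hG : ∀ f, G f = F (List.ofFn f))
    (hF : ∀ f : Fin n → ℕ+, ∀ i, d (f i) = 0 → MvPowerSeries.coeff d (G f) = 0) :
    MvPowerSeries.coeff d (msum (fun m : {f : Fin n → ℕ+ // P f} => G m.1)) =
      MvPowerSeries.coeff d
        (LS (d.support.sort (· ≤ ·)) n (fun l => if Q l then F l else 0)) := by
  classical
  rw [LS_eq_sum, map_sum]
  have : MvPowerSeries.coeff d (msum (fun m : {f : Fin n → ℕ+ // P f} => G m.1)) =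
    ∑' m : {f : Fin n → ℕ+ // P f}, MvPowerSeries.coeff d (G m.1) := rfl
  rw [this]
  refine (tsum_subtype {f | P f} (fun f => MvPowerSeries.coeff d (G f))).trans ?_
  rw [tsum_eq_sum (s := Fintype.piFinset (fun _ : Fin n => d.support))]
  · refine Finset.sum_congr rfl fun f _ => ?_
    rw [← hG]
    by_cases h : P f
    · rw [if_pos ((hPQ f).1 h), Set.indicator_of_mem (by exact h)]
    · rw [if_neg (fun h' => h ((hPQ f).2 h')), Set.indicator_of_notMem (by exact h), map_zero]
  · intro f hf
    rw [Fintype.mem_piFinset, not_forall] at hf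
    obtain ⟨i, hi⟩ := hf
    rw [Finsupp.notMem_support_iff] at hi
    rw [Set.indicator_apply, hF f i hi, ite_self]

theorem prod_eq_wt (X : ℕ+ → R) (ks : List ℕ+) (f : Fin ks.length → ℕ+) :
    ∏ j : Fin ks.length, X (f j) ^ ((ks.get j : ℕ)) = wt X ks (List.ofFn f) := by
  rw [wt, ← List.prod_ofFn]
  congr 1
  apply List.ext_getElem
  · simp
  · intro i h1 h2
    simp

theorem prod_vanish (d : ℕ+ →₀ ℕ) (ks : List ℕ+) (f : Fin ks.length → ℕ+) (i : Fin ks.length)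
    (hi : d (f i) = 0) (Y : QS) :
    MvPowerSeries.coeff d ((∏ j : Fin ks.length,
      (MvPowerSeries.X (f j) : QS) ^ ((ks.get j : ℕ))) * Y) = 0 := by
  have : (MvPowerSeries.X (f i) : QS) ∣ (∏ j : Fin ks.length,
      (MvPowerSeries.X (f j) : QS) ^ ((ks.get j : ℕ))) * Y :=
    ((dvd_pow_self _ (ks.get i).ne_zero).trans
      (Finset.dvd_prod_of_mem (fun j => (MvPowerSeries.X (f j) : QS) ^ ((ks.get j : ℕ)))
        (Finset.mem_univ i))).mul_right Y
  exact MvPowerSeries.X_dvd_iff.1 this d hi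

theorem coeff_Phi (d : ℕ+ →₀ ℕ) (h : H1) :
    MvPowerSeries.coeff d (Phi h) = MvPowerSeries.coeff d
      (lc (FF (fun m => (MvPowerSeries.X m : QS)) (d.support.sort (· ≤ ·))) h) := by
  rw [Phi, lc, Finsupp.linearCombination_apply, Finsupp.sum, Finsupp.sum, map_sum, map_sum]
  refine Finset.sum_congr rfl fun ks _ => ?_
  rw [map_smul, map_smul]
  congr 1
  rw [FF_eq_LS _ _ (Finset.sortedLT_sort _).pairwise]
  refine msum_coeff d ks.length StrictMono (List.Pairwise (· < ·)) ?_ (fun f => ∏ j : Fin ks.length,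
      (MvPowerSeries.X (f j) : QS) ^ ((ks.get j : ℕ))) _ ?_ ?_
  · intro f
    rw [List.pairwise_ofFn]
    rfl
  · exact prod_eq_wt _ ks
  · intro f i hi
    simpa using prod_vanish d ks f i hi 1

theorem PB_ofFn (n : ℕ) (j : Fin n) (f : Fin n → ℕ+) :
    ((∀ a b : Fin n, a < b → b ≤ j → f a < f b) ∧ (∀ a b : Fin n, j ≤ a → a ≤ b → f b ≤ f a)) ↔
      PB j (List.ofFn f) := by
  simp only [PB, take_pw, drop_pw, List.length_ofFn, List.getElem_ofFn]
  constructor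
  · rintro ⟨h1, h2⟩
    refine ⟨fun a b hb hab h => h1 _ _ hab (Nat.lt_succ_iff.1 h), fun a b hb hab h => h2 _ _ h hab.le⟩
  · rintro ⟨h1, h2⟩
    refine ⟨fun a b hab hb => h1 a b b.2 hab (Nat.lt_succ_iff.2 hb), fun a b ha hab => ?_⟩
    rcases hab.lt_or_eq with h | h
    · exact h2 a b b.2 h ha
    · rw [h]

end PhiPsiAux

/-- equation for `Φ(ψ(z_{k₁}⋯z_{k_r}))`: the quasisymmetric realization
of `ψ(z_{k₁}⋯z_{k_r})` equals
`Σ_{j=1}^{r} k_j (-1)^{r-j+1} Σ_{0<m₁<⋯<m_j, 0<m_r≤⋯≤m_j} t_{m₁}^{k₁}⋯t_{m_r}^{k_r}·t_{m_j}`. -/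
theorem Phi_psi_formula (ks : List ℕ+) :
    Phi (psi (W ks)) =
      ∑ j : Fin ks.length,
        (((ks.get j : ℕ) : ℚ) * (-1) ^ (ks.length - (j : ℕ))) •
          msum (fun m : {f : Fin ks.length → ℕ+ //
              (∀ a b : Fin ks.length, a < b → b ≤ j → f a < f b) ∧
              (∀ a b : Fin ks.length, j ≤ a → a ≤ b → f b ≤ f a)} =>
            (∏ i : Fin ks.length, (MvPowerSeries.X (m.1 i)) ^ ((ks.get i : ℕ))) *
              MvPowerSeries.X (m.1 j)) := by
  classical
  ext d
  have h0 : psi (W ks) = psiW ks := by simp [psi, W]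
  rw [coeff_Phi, h0, FF_psi _ _ (Finset.sortedLT_sort _).pairwise, map_sum, map_sum]
  refine Finset.sum_congr rfl fun j _ => ?_
  have e : (((ks.get j : ℕ) : QS) * (-1) ^ (ks.length - (j : ℕ))) =
      algebraMap ℚ QS (((ks.get j : ℕ) : ℚ) * (-1) ^ (ks.length - (j : ℕ))) := by
    simp only [map_mul, map_natCast, map_pow, map_neg, map_one]
  rw [e, ← Algebra.smul_def, map_smul, map_smul]
  congr 1
  symm
  refine msum_coeff d ks.length _ (PB j) (PB_ofFn _ j) (fun f => (∏ i : Fin ks.length,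
      (MvPowerSeries.X (f i) : QS) ^ ((ks.get i : ℕ))) * MvPowerSeries.X (f j)) _ ?_ ?_
  · intro f
    rw [prod_eq_wt (fun m => (MvPowerSeries.X m : QS)) ks f]
    simp
  · intro f i hi
    exact prod_vanish d ks f i hi _
end

section
/- The map λ : H¹ → H¹[[α]] defined by λ(z_{k₁}⋯z_{k_r}) = Σ_{m=0}^{∞} α^m Σ_{i=0}^{r} z_{k₁}⋯z_{k_i} ∗ S̃(σ_m(z_{k_r}⋯z_{k_{i+1}})) (and λ(1) = 1) is a homomorphism for the harmonic product: λ(u ∗ v) = λ(u) ∗ λ(v) for all u, v ∈ H¹. -/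
open scoped BigOperators

/-- `λ` on words: the coefficient of `α^m` in
`λ(z_{k₁}⋯z_{k_r}) = Σ_m α^m Σ_{i=0}^{r} z_{k₁}⋯z_{k_i} ∗ S̃(σ_m(z_{k_r}⋯z_{k_{i+1}}))`. -/
noncomputable def lamW (ks : List ℕ+) (m : ℕ) : H1 :=
  ∑ i ∈ Finset.range (ks.length + 1), harm (W (ks.take i)) (Stt (sigW m ((ks.drop i).reverse)))

/-- `λ : H¹ → H¹[[α]]` (a power series given by its coefficients), linear extension. -/
noncomputable def lam (h : H1) (m : ℕ) : H1 := h.sum fun ks c => c • lamW ks m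


namespace LamHom

/-- consing as a linear map -/
noncomputable def cons (k : ℕ+) : H1 →ₗ[ℚ] H1 := Finsupp.lmapDomain ℚ ℚ (fun w => k :: w)
/-- appending a letter as a linear map -/
noncomputable def snoc (k : ℕ+) : H1 →ₗ[ℚ] H1 := Finsupp.lmapDomain ℚ ℚ (fun w => w ++ [k])
/-- linear extension of a function on words -/
noncomputable def ex {M : Type*} [AddCommGroup M] [Module ℚ M] (f : List ℕ+ → M) : H1 →ₗ[ℚ] M :=
  Finsupp.linearCombination ℚ f

theorem consL_eq (k : ℕ+) (h : H1) : consL k h = cons k h := rfl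

theorem cons_W (k : ℕ+) (w : List ℕ+) : cons k (W w) = W (k :: w) := by
  simp [cons, W]

theorem snoc_W (k : ℕ+) (w : List ℕ+) : snoc k (W w) = W (w ++ [k]) := by
  simp [snoc, W]

theorem ex_W {M : Type*} [AddCommGroup M] [Module ℚ M] (f : List ℕ+ → M) (w : List ℕ+) :
    ex f (W w) = f w := by
  simp [ex, W]

theorem word_ind {P : H1 → Prop} (h0 : P 0) (hadd : ∀ a b, P a → P b → P (a + b))
    (hsmul : ∀ (c : ℚ) a, P a → P (c • a)) (hW : ∀ w, P (W w)) (x : H1) : P x := by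
  induction x using Finsupp.induction_linear with
  | zero => exact h0
  | add f g hf hg => exact hadd _ _ hf hg
  | single a b =>
    have := hsmul b _ (hW a)
    simpa [W] using this

theorem lin_ext {M : Type*} [AddCommGroup M] [Module ℚ M] {f g : H1 →ₗ[ℚ] M}
    (h : ∀ w, f (W w) = g (W w)) (x : H1) : f x = g x := by
  induction x using word_ind with
  | h0 => simp
  | hadd a b ha hb => simp [ha, hb]
  | hsmul c a ha => simp [ha]
  | hW w => exact h w

theorem bilin_ext {M : Type*} [AddCommGroup M] [Module ℚ M] {f g : H1 →ₗ[ℚ] H1 →ₗ[ℚ] M}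
    (h : ∀ u v, f (W u) (W v) = g (W u) (W v)) (x y : H1) : f x y = g x y := by
  have : f x = g x := lin_ext (fun w => LinearMap.ext (lin_ext (h w))) x
  rw [this]

/-- the harmonic product as a bilinear map -/
noncomputable def mu : H1 →ₗ[ℚ] H1 →ₗ[ℚ] H1 := ex (fun u => ex (harmW u))

theorem harm_eq (g h : H1) : harm g h = mu g h := by
  simp only [harm, mu, ex, Finsupp.linearCombination_apply, Finsupp.sum, LinearMap.sum_apply,
    LinearMap.smul_apply, Finset.smul_sum, smul_smul]

theorem mu_W (u v : List ℕ+) : mu (W u) (W v) = harmW u v := by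
  simp [mu, ex_W]

theorem harmW_nil_left (v : List ℕ+) : harmW [] v = W v := by simp [harmW]
theorem harmW_nil_right (u : List ℕ+) : harmW u [] = W u := by cases u <;> simp [harmW]
theorem harmW_cons (k l : ℕ+) (u v : List ℕ+) : harmW (k :: u) (l :: v) =
    cons k (harmW u (l :: v)) + cons l (harmW (k :: u) v) + cons (k + l) (harmW u v) := by
  simp [harmW, consL_eq]

theorem one_mu (x : H1) : mu (W []) x = x :=
  lin_ext (f := mu (W [])) (g := LinearMap.id) (fun w => by simp [mu_W, harmW_nil_left]) x

theorem mu_one (x : H1) : mu x (W []) = x :=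
  lin_ext (f := mu.flip (W [])) (g := LinearMap.id) (fun w => by simp [mu_W, harmW_nil_right]) x

theorem mu_cons (k l : ℕ+) (x y : H1) : mu (cons k x) (cons l y) =
    cons k (mu x (cons l y)) + cons l (mu (cons k x) y) + cons (k + l) (mu x y) := by
  have := bilin_ext (f := mu.compl₁₂ (cons k) (cons l))
    (g := (mu.compl₁₂ LinearMap.id (cons l)).compr₂ (cons k) +
      (mu.compl₁₂ (cons k) LinearMap.id).compr₂ (cons l) + mu.compr₂ (cons (k+l)))
    (fun u v => by simp [cons_W, mu_W, harmW_cons]) x y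
  simpa using this

theorem harmW_comm : ∀ u v, harmW u v = harmW v u
  | [], v => by rw [harmW_nil_left, harmW_nil_right]
  | u, [] => by rw [harmW_nil_left, harmW_nil_right]
  | k :: u, l :: v => by
    rw [harmW_cons, harmW_cons, harmW_comm u (l :: v), harmW_comm (k :: u) v, harmW_comm u v,
      add_comm k l]
    abel
  termination_by u v => u.length + v.length

theorem mu_comm (x y : H1) : mu x y = mu y x :=
  bilin_ext (f := mu) (g := mu.flip) (fun u v => by simp [mu_W, harmW_comm u v]) x y

theorem mu_assoc_W : ∀ u v w, mu (mu (W u) (W v)) (W w) = mu (W u) (mu (W v) (W w))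
  | [], v, w => by simp [one_mu]
  | u, [], w => by simp [one_mu, mu_one]
  | u, v, [] => by simp [mu_one]
  | k :: u, l :: v, m :: w => by
    have h1 := mu_assoc_W u (l :: v) (m :: w)
    have h2 := mu_assoc_W (k :: u) v (m :: w)
    have h3 := mu_assoc_W (k :: u) (l :: v) w
    have h4 := mu_assoc_W u v (m :: w)
    have h5 := mu_assoc_W u (l :: v) w
    have h6 := mu_assoc_W (k :: u) v w
    have h7 := mu_assoc_W u v w
    simp only [← cons_W] at *
    have e : mu (mu (cons k (W u)) (cons l (W v))) (cons m (W w)) =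
        cons k (mu (mu (W u) (cons l (W v))) (cons m (W w)))
        + cons l (mu (mu (cons k (W u)) (W v)) (cons m (W w)))
        + cons (k + l) (mu (mu (W u) (W v)) (cons m (W w)))
        + cons m (mu (mu (cons k (W u)) (cons l (W v))) (W w))
        + cons (k + m) (mu (mu (W u) (cons l (W v))) (W w))
        + cons (l + m) (mu (mu (cons k (W u)) (W v)) (W w))
        + cons (k + l + m) (mu (mu (W u) (W v)) (W w)) := by
      rw [mu_cons]
      simp only [map_add, LinearMap.add_apply, mu_cons]
      abel
    have e' : mu (cons k (W u)) (mu (cons l (W v)) (cons m (W w))) =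
        cons k (mu (W u) (mu (cons l (W v)) (cons m (W w))))
        + cons l (mu (cons k (W u)) (mu (W v) (cons m (W w))))
        + cons (k + l) (mu (W u) (mu (W v) (cons m (W w))))
        + cons m (mu (cons k (W u)) (mu (cons l (W v)) (W w)))
        + cons (k + m) (mu (W u) (mu (cons l (W v)) (W w)))
        + cons (l + m) (mu (cons k (W u)) (mu (W v) (W w)))
        + cons (k + l + m) (mu (W u) (mu (W v) (W w))) := by
      rw [mu_cons l m]
      simp only [map_add, mu_cons, add_assoc]
      abel
    rw [e, e', h1, h2, h3, h4, h5, h6, h7]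
  termination_by u v w => u.length + v.length + w.length

theorem mu_assoc (x y z : H1) : mu (mu x y) z = mu x (mu y z) := by
  induction x using word_ind with
  | h0 => simp
  | hadd a b ha hb => simp [ha, hb]
  | hsmul c a ha => simp [ha]
  | hW u =>
    have := bilin_ext (f := mu.comp (mu (W u))) (g := mu.compr₂ (mu (W u)))
      (fun v w => by simpa using mu_assoc_W u v w) y z
    simpa using this

/-! Reversal -/

theorem snoc_cons (k l : ℕ+) (x : H1) : snoc k (cons l x) = cons l (snoc k x) :=
  lin_ext (f := (snoc k).comp (cons l)) (g := (cons l).comp (snoc k))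
    (fun w => by simp [snoc_W, cons_W]) x

theorem harmW_snoc (k l : ℕ+) : ∀ u v, harmW (u ++ [k]) (v ++ [l]) =
    snoc k (harmW u (v ++ [l])) + snoc l (harmW (u ++ [k]) v) + snoc (k + l) (harmW u v)
  | [], [] => by
    simp [harmW_cons, harmW_nil_left, harmW_nil_right, cons_W, snoc_W]; abel
  | [], m :: v => by
    have h := harmW_snoc k l [] v
    simp only [List.nil_append, List.cons_append, harmW_cons, harmW_nil_left, harmW_nil_right,
      map_add, snoc_cons, snoc_W, cons_W] at *
    simp only [h, map_add, cons_W]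
    abel
  | p :: u, [] => by
    have h := harmW_snoc k l u []
    simp only [List.nil_append, List.cons_append, harmW_cons, harmW_nil_left, harmW_nil_right,
      map_add, snoc_cons, snoc_W, cons_W] at *
    simp only [h, map_add, cons_W]
    abel
  | p :: u, m :: v => by
    have h1 := harmW_snoc k l u (m :: v)
    have h2 := harmW_snoc k l (p :: u) v
    have h3 := harmW_snoc k l u v
    simp only [List.cons_append] at *
    rw [harmW_cons, h1, h2, h3, harmW_cons, harmW_cons, harmW_cons]
    simp only [map_add, snoc_cons]
    abel
  termination_by u v => u.length + v.length

/-- reversal of words -/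
noncomputable def rv : H1 →ₗ[ℚ] H1 := ex (fun w => W w.reverse)

theorem rv_cons (k : ℕ+) (x : H1) : rv (cons k x) = snoc k (rv x) :=
  lin_ext (f := rv.comp (cons k)) (g := (snoc k).comp rv)
    (fun w => by simp [rv, snoc_W, cons_W, ex_W]) x

theorem rv_harmW : ∀ u v, rv (harmW u v) = harmW u.reverse v.reverse
  | [], v => by simp [harmW_nil_left, rv, ex_W]
  | u, [] => by simp [harmW_nil_right, rv, ex_W]
  | k :: u, l :: v => by
    rw [harmW_cons]
    simp only [map_add, rv_cons]
    rw [rv_harmW u (l :: v), rv_harmW (k :: u) v, rv_harmW u v]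
    simp only [List.reverse_cons, harmW_snoc]
  termination_by u v => u.length + v.length

theorem rv_mu (x y : H1) : rv (mu x y) = mu (rv x) (rv y) := by
  have := bilin_ext (f := mu.compr₂ rv) (g := mu.compl₁₂ rv rv)
    (fun u v => by simp [mu_W, rv_harmW]; simp [rv, ex_W, mu_W]) x y
  simpa using this

/-! The map `S̃` -/

/-- merge a letter into the first letter of a word -/
noncomputable def mgW (k : ℕ+) : List ℕ+ → H1
  | [] => 0
  | l :: w => W ((k + l) :: w)
/-- linear extension of `mgW` -/
noncomputable def mg (k : ℕ+) : H1 →ₗ[ℚ] H1 := ex (mgW k)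

theorem mg_cons (k l : ℕ+) (x : H1) : mg k (cons l x) = cons (k + l) x :=
  lin_ext (f := (mg k).comp (cons l)) (g := cons (k + l))
    (fun w => by simp [mg, mgW, cons_W, ex_W]) x

theorem mg_one (k : ℕ+) : mg k (W []) = 0 := by simp [mg, ex_W, mgW]

theorem StW_cons : ∀ k w, StW (k :: w) = cons k (StW w) + mg k (StW w)
  | k, [] => by simp [StW, cons_W, mg_one]
  | k, l :: w => by
    rw [StW, consL_eq, StW_cons l w, StW_cons (k + l) w]
    simp only [map_add, mg_cons]
    have : ∀ x, mg k (mg l x) = mg (k + l) x := lin_ext (f := (mg k).comp (mg l))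
      (fun w => by cases w <;> simp [mg, ex_W, mgW, add_assoc])
    rw [this]
  termination_by k w => w.length

/-- the operator `N_k` -/
noncomputable def N (k : ℕ+) : H1 →ₗ[ℚ] H1 := cons k + mg k

theorem N_def (k : ℕ+) (x : H1) : N k x = cons k x + mg k x := rfl

theorem SttW_cons (k : ℕ+) (w : List ℕ+) : SttW (k :: w) = - N k (SttW w) := by
  simp [SttW, StW_cons, N_def, pow_succ]
  abel

set_option maxHeartbeats 2000000 in
theorem N_mu_W (k l : ℕ+) (u v : List ℕ+) : mu (N k (W u)) (N l (W v)) =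
    N k (mu (W u) (N l (W v))) + N l (mu (N k (W u)) (W v)) - N (k + l) (mu (W u) (W v)) := by
  rcases u with _ | ⟨p, u⟩ <;> rcases v with _ | ⟨q, v⟩ <;>
  simp only [← cons_W, N_def, mg_one, mg_cons, map_add, LinearMap.add_apply, mu_cons, one_mu,
    mu_one, add_zero] <;>
  simp only [@add_comm ℕ+ _, @add_left_comm ℕ+ _] <;> abel

theorem N_mu (k l : ℕ+) (x y : H1) : mu (N k x) (N l y) =
    N k (mu x (N l y)) + N l (mu (N k x) y) - N (k + l) (mu x y) := by
  have := bilin_ext (f := mu.compl₁₂ (N k) (N l))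
    (g := (mu.compl₁₂ LinearMap.id (N l)).compr₂ (N k) +
      (mu.compl₁₂ (N k) LinearMap.id).compr₂ (N l) - mu.compr₂ (N (k+l)))
    (fun u v => by simpa using N_mu_W k l u v) x y
  simpa using this

/-- `S̃` as a linear map -/
noncomputable def SL : H1 →ₗ[ℚ] H1 := ex SttW

theorem Stt_eq (x : H1) : Stt x = SL x := rfl

theorem SL_one : SL (W []) = W [] := by simp [SL, ex_W, SttW, StW]

theorem SL_cons (k : ℕ+) (x : H1) : SL (cons k x) = - N k (SL x) := 
  lin_ext (f := SL.comp (cons k)) (g := - (N k).comp SL)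
    (fun w => by simp [SL, cons_W, ex_W, SttW_cons]) x

theorem SL_mu_W : ∀ u v, SL (mu (W u) (W v)) = mu (SL (W u)) (SL (W v))
  | [], v => by simp [one_mu, SL_one]
  | u, [] => by simp [mu_one, SL_one]
  | k :: u, l :: v => by
    have h1 := SL_mu_W u (l :: v)
    have h2 := SL_mu_W (k :: u) v
    have h3 := SL_mu_W u v
    simp only [← cons_W] at *
    rw [mu_cons]
    simp only [map_add, SL_cons, h1, h2, h3, map_neg, LinearMap.neg_apply, N_mu]
    abel
  termination_by u v => u.length + v.length

theorem SL_mu (x y : H1) : SL (mu x y) = mu (SL x) (SL y) := by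
  have := bilin_ext (f := mu.compr₂ SL) (g := mu.compl₁₂ SL SL)
    (fun u v => by simpa using SL_mu_W u v) x y
  simpa using this

/-! The map `σ` -/

/-- binomial coefficients in `σ` -/
noncomputable def cf (k : ℕ+) (e : ℕ) : ℚ := (((k : ℕ) + e - 1).choose e : ℚ)

theorem cf_conv (k l : ℕ+) (n : ℕ) :
    ∑ p ∈ Finset.HasAntidiagonal.antidiagonal n, cf k p.1 * cf l p.2 = cf (k + l) n := by
  have key : ∀ (k : ℕ+) (e : ℕ), cf k e =
      PowerSeries.coeff e (PowerSeries.invOneSubPow ℚ (k : ℕ)).val := by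
    intro k e
    rw [PowerSeries.invOneSubPow_val_eq_mk_sub_one_add_choose_of_pos _ _ k.pos,
      PowerSeries.coeff_mk, cf]
    have := k.pos
    congr 1
    rw [show (k : ℕ) + e - 1 = (k - 1) + e by omega]
    exact (Nat.choose_symm_add).symm
  simp only [key]
  rw [← PowerSeries.coeff_mul, PNat.add_coe, PowerSeries.invOneSubPow_add, Units.val_mul]

theorem T1 (n : ℕ) (G : ℕ → ℕ → ℕ → ℕ → H1) :
    ∑ p ∈ Finset.HasAntidiagonal.antidiagonal n, ∑ q ∈ Finset.HasAntidiagonal.antidiagonal p.2,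
      ∑ r ∈ Finset.HasAntidiagonal.antidiagonal q.2, G p.1 q.1 r.1 r.2 =
    ∑ p ∈ Finset.HasAntidiagonal.antidiagonal n, ∑ q ∈ Finset.HasAntidiagonal.antidiagonal p.1,
      ∑ r ∈ Finset.HasAntidiagonal.antidiagonal p.2, G q.1 q.2 r.1 r.2 := by
  simp only [Finset.sum_sigma']
  refine Finset.sum_nbij'
    (fun x => ⟨(x.1.1 + x.2.1.1, x.2.2.1 + x.2.2.2), (x.1.1, x.2.1.1), (x.2.2.1, x.2.2.2)⟩)
    (fun x => ⟨(x.2.1.1, x.2.1.2 + (x.2.2.1 + x.2.2.2)), (x.2.1.2, x.2.2.1 + x.2.2.2), (x.2.2.1, x.2.2.2)⟩)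
    ?_ ?_ ?_ ?_ ?_
  all_goals
    rintro ⟨⟨a, b⟩, ⟨c, d⟩, ⟨e, f⟩⟩ h
    simp only [Finset.mem_sigma, Finset.HasAntidiagonal.mem_antidiagonal] at h ⊢
  · obtain ⟨h1, h2, h3⟩ := h
    refine ⟨?_, ?_, ?_⟩ <;> first | trivial | omega
  · obtain ⟨h1, h2, h3⟩ := h
    refine ⟨?_, ?_, ?_⟩ <;> first | trivial | omega
  · obtain ⟨h1, h2, h3⟩ := h
    subst h3; subst h2; rfl
  · obtain ⟨h1, h2, h3⟩ := h
    subst h3; subst h2; rfl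

theorem T2 (n : ℕ) (G : ℕ → ℕ → ℕ → ℕ → H1) :
    ∑ p ∈ Finset.HasAntidiagonal.antidiagonal n, ∑ q ∈ Finset.HasAntidiagonal.antidiagonal p.2,
      ∑ r ∈ Finset.HasAntidiagonal.antidiagonal q.1, G r.1 r.2 p.1 q.2 =
    ∑ p ∈ Finset.HasAntidiagonal.antidiagonal n, ∑ q ∈ Finset.HasAntidiagonal.antidiagonal p.1,
      ∑ r ∈ Finset.HasAntidiagonal.antidiagonal p.2, G q.1 q.2 r.1 r.2 := by
  simp only [Finset.sum_sigma']
  refine Finset.sum_nbij'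
    (fun x => ⟨(x.2.2.1 + x.2.2.2, x.1.1 + x.2.1.2), (x.2.2.1, x.2.2.2), (x.1.1, x.2.1.2)⟩)
    (fun x => ⟨(x.2.2.1, (x.2.1.1 + x.2.1.2) + x.2.2.2), (x.2.1.1 + x.2.1.2, x.2.2.2),
      (x.2.1.1, x.2.1.2)⟩)
    ?_ ?_ ?_ ?_ ?_
  all_goals
    rintro ⟨⟨a, b⟩, ⟨c, d⟩, ⟨e, f⟩⟩ h
    simp only [Finset.mem_sigma, Finset.HasAntidiagonal.mem_antidiagonal] at h ⊢
  · obtain ⟨h1, h2, h3⟩ := h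
    refine ⟨?_, ?_, ?_⟩ <;> first | trivial | omega
  · obtain ⟨h1, h2, h3⟩ := h
    refine ⟨?_, ?_, ?_⟩ <;> first | trivial | omega
  · obtain ⟨h1, h2, h3⟩ := h
    subst h3; subst h2; rfl
  · obtain ⟨h1, h2, h3⟩ := h
    subst h3; subst h2; rfl

theorem T3 (n : ℕ) (G : ℕ → ℕ → ℕ → ℕ → H1) :
    ∑ p ∈ Finset.HasAntidiagonal.antidiagonal n, ∑ q ∈ Finset.HasAntidiagonal.antidiagonal p.1,
      ∑ r ∈ Finset.HasAntidiagonal.antidiagonal p.2, G q.1 r.1 q.2 r.2 =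
    ∑ p ∈ Finset.HasAntidiagonal.antidiagonal n, ∑ q ∈ Finset.HasAntidiagonal.antidiagonal p.1,
      ∑ r ∈ Finset.HasAntidiagonal.antidiagonal p.2, G q.1 q.2 r.1 r.2 := by
  simp only [Finset.sum_sigma']
  refine Finset.sum_nbij'
    (fun x => ⟨(x.2.1.1 + x.2.2.1, x.2.1.2 + x.2.2.2), (x.2.1.1, x.2.2.1), (x.2.1.2, x.2.2.2)⟩)
    (fun x => ⟨(x.2.1.1 + x.2.2.1, x.2.1.2 + x.2.2.2), (x.2.1.1, x.2.2.1), (x.2.1.2, x.2.2.2)⟩)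
    ?_ ?_ ?_ ?_ ?_
  all_goals
    rintro ⟨⟨a, b⟩, ⟨c, d⟩, ⟨e, f⟩⟩ h
    simp only [Finset.mem_sigma, Finset.HasAntidiagonal.mem_antidiagonal] at h ⊢
  · obtain ⟨h1, h2, h3⟩ := h
    refine ⟨?_, ?_, ?_⟩ <;> first | trivial | omega
  · obtain ⟨h1, h2, h3⟩ := h
    refine ⟨?_, ?_, ?_⟩ <;> first | trivial | omega
  · obtain ⟨h1, h2, h3⟩ := h
    subst h3; subst h2; rfl
  · obtain ⟨h1, h2, h3⟩ := h
    subst h3; subst h2; rfl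

/-- action of a letter on sequences of coefficients -/
noncomputable def Zc (k : ℕ+) (a : ℕ → H1) (n : ℕ) : H1 :=
  ∑ p ∈ Finset.HasAntidiagonal.antidiagonal n, cf k p.1 • cons (pplus k p.1) (a p.2)

/-- Cauchy product of sequences of coefficients -/
noncomputable def cv (a b : ℕ → H1) (n : ℕ) : H1 :=
  ∑ p ∈ Finset.HasAntidiagonal.antidiagonal n, mu (a p.1) (b p.2)

theorem pplus_add (k l : ℕ+) (e f : ℕ) : pplus k e + pplus l f = pplus (k + l) (e + f) := by
  apply PNat.eq
  change ((k : ℕ) + e) + (l + f) = (k + l) + (e + f)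
  omega

theorem cv_Zc (k l : ℕ+) (a b : ℕ → H1) (n : ℕ) : cv (Zc k a) (Zc l b) n =
    Zc k (cv a (Zc l b)) n + Zc l (cv (Zc k a) b) n + Zc (k + l) (cv a b) n := by
  have h0 : cv (Zc k a) (Zc l b) n = ∑ p ∈ Finset.HasAntidiagonal.antidiagonal n, ∑ q ∈ Finset.HasAntidiagonal.antidiagonal p.1,
      ∑ r ∈ Finset.HasAntidiagonal.antidiagonal p.2, (cf k q.1 * cf l r.1) •
        mu (cons (pplus k q.1) (a q.2)) (cons (pplus l r.1) (b r.2)) := by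
    simp only [cv, Zc, map_sum, LinearMap.sum_apply, map_smul, LinearMap.smul_apply, smul_smul,
      Finset.smul_sum]
    refine Finset.sum_congr rfl fun p _ => ?_
    rw [Finset.sum_comm]
    refine Finset.sum_congr rfl fun q _ => Finset.sum_congr rfl fun r _ => ?_
    rw [mul_comm]
  have h1 : Zc k (cv a (Zc l b)) n = ∑ p ∈ Finset.HasAntidiagonal.antidiagonal n, ∑ q ∈ Finset.HasAntidiagonal.antidiagonal p.1,
      ∑ r ∈ Finset.HasAntidiagonal.antidiagonal p.2, (cf k q.1 * cf l r.1) •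
        cons (pplus k q.1) (mu (a q.2) (cons (pplus l r.1) (b r.2))) := by
    rw [← T1 n (fun e i f j => (cf k e * cf l f) •
        cons (pplus k e) (mu (a i) (cons (pplus l f) (b j))))]
    simp only [cv, Zc, map_sum, LinearMap.sum_apply, map_smul, LinearMap.smul_apply, smul_smul,
      Finset.smul_sum]
  have h2 : Zc l (cv (Zc k a) b) n = ∑ p ∈ Finset.HasAntidiagonal.antidiagonal n, ∑ q ∈ Finset.HasAntidiagonal.antidiagonal p.1,
      ∑ r ∈ Finset.HasAntidiagonal.antidiagonal p.2, (cf k q.1 * cf l r.1) •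
        cons (pplus l r.1) (mu (cons (pplus k q.1) (a q.2)) (b r.2)) := by
    rw [← T2 n (fun e i f j => (cf k e * cf l f) •
        cons (pplus l f) (mu (cons (pplus k e) (a i)) (b j)))]
    simp only [cv, Zc, map_sum, LinearMap.sum_apply, map_smul, LinearMap.smul_apply, smul_smul,
      Finset.smul_sum]
    refine Finset.sum_congr rfl fun p _ => Finset.sum_congr rfl fun q _ =>
      Finset.sum_congr rfl fun r _ => ?_
    rw [mul_comm]
  have h3 : Zc (k + l) (cv a b) n = ∑ p ∈ Finset.HasAntidiagonal.antidiagonal n, ∑ q ∈ Finset.HasAntidiagonal.antidiagonal p.1,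
      ∑ r ∈ Finset.HasAntidiagonal.antidiagonal p.2, (cf k q.1 * cf l r.1) •
        cons (pplus k q.1 + pplus l r.1) (mu (a q.2) (b r.2)) := by
    rw [← T3 n (fun e i f j => (cf k e * cf l f) •
        cons (pplus k e + pplus l f) (mu (a i) (b j)))]
    simp only [cv, Zc, ← cf_conv, map_sum, Finset.smul_sum, Finset.sum_smul]
    refine Finset.sum_congr rfl fun p _ => ?_
    rw [Finset.sum_comm]
    refine Finset.sum_congr rfl fun q hq => Finset.sum_congr rfl fun r _ => ?_
    rw [pplus_add, Finset.HasAntidiagonal.mem_antidiagonal.1 hq]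
  rw [h0, h1, h2, h3]
  simp only [← Finset.sum_add_distrib, ← smul_add, mu_cons]

/-- `σ_m` as a linear map -/
noncomputable def sg (m : ℕ) : H1 →ₗ[ℚ] H1 := ex (sigW m)

theorem sigW_cons (k : ℕ+) (w : List ℕ+) (m : ℕ) :
    sigW m (k :: w) = Zc k (fun i => sigW i w) m := by
  rw [Zc, Finset.Nat.sum_antidiagonal_eq_sum_range_succ
    (fun e i => cf k e • cons (pplus k e) (sigW i w)), sigW]
  rfl

theorem sg_cons (k : ℕ+) (x : H1) (m : ℕ) : sg m (cons k x) = Zc k (fun i => sg i x) m := by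
  have := lin_ext (f := (sg m).comp (cons k))
    (g := ∑ p ∈ Finset.HasAntidiagonal.antidiagonal m, cf k p.1 • (cons (pplus k p.1)).comp (sg p.2))
    (fun w => by simp [sg, ex_W, cons_W, sigW_cons, Zc]) x
  simpa [Zc] using this

theorem sg_one (m : ℕ) : sg m (W []) = if m = 0 then W [] else 0 := by
  simp [sg, ex_W, sigW]

theorem sg_mu_W : ∀ u v m, sg m (mu (W u) (W v)) =
    cv (fun i => sg i (W u)) (fun i => sg i (W v)) m
  | [], v, m => by
    rw [cv, Finset.sum_eq_single (0, m)]
    · simp [sg_one, one_mu]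
    · rintro ⟨i, j⟩ h hne
      have : i ≠ 0 := by
        rintro rfl
        simp at h; simp [h] at hne
      simp [sg_one, this]
    · simp
  | u, [], m => by
    rw [cv, Finset.sum_eq_single (m, 0)]
    · simp [sg_one, mu_one]
    · rintro ⟨i, j⟩ h hne
      have : j ≠ 0 := by
        rintro rfl
        simp at h; simp [h] at hne
      simp [sg_one, this]
    · simp
  | k :: u, l :: v, m => by
    have h1 := sg_mu_W u (l :: v)
    have h2 := sg_mu_W (k :: u) v
    have h3 := sg_mu_W u v
    simp only [← cons_W] at *
    rw [mu_cons]
    simp only [map_add, sg_cons] at *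
    simp only [h1, h2, h3]
    exact (cv_Zc k l _ _ m).symm
  termination_by u v => u.length + v.length

theorem sg_mu (x y : H1) (m : ℕ) : sg m (mu x y) =
    ∑ p ∈ Finset.HasAntidiagonal.antidiagonal m, mu (sg p.1 x) (sg p.2 y) := by
  have := bilin_ext (f := mu.compr₂ (sg m))
    (g := ∑ p ∈ Finset.HasAntidiagonal.antidiagonal m, mu.compl₁₂ (sg p.1) (sg p.2))
    (fun u v => by simpa [cv] using sg_mu_W u v m) x y
  simpa using this

/-! Deconcatenation -/

section conv
variable {B : Type*} [CommRing B] [Algebra ℚ B]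

/-- sum over all deconcatenations of a word -/
def ssum {B : Type*} [AddCommMonoid B] : List ℕ+ → (List ℕ+ → List ℕ+ → B) → B
  | [], φ => φ [] []
  | k :: w, φ => φ [] (k :: w) + ssum w (fun a b => φ (k :: a) b)

theorem ssum_range (w : List ℕ+) (φ : List ℕ+ → List ℕ+ → B) :
    ssum w φ = ∑ i ∈ Finset.range (w.length + 1), φ (w.take i) (w.drop i) := by
  induction w generalizing φ with
  | nil => simp [ssum]
  | cons k w ih =>
    rw [ssum, ih, List.length_cons, Finset.sum_range_succ' _ (w.length + 1), add_comm]
    rfl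

theorem ssum_add (w : List ℕ+) (φ ψ : List ℕ+ → List ℕ+ → B) :
    ssum w (fun a b => φ a b + ψ a b) = ssum w φ + ssum w ψ := by
  simp only [ssum_range, Finset.sum_add_distrib]

/-- convolution product -/
def conv (f g : List ℕ+ → B) (w : List ℕ+) : B := ssum w (fun a b => f a * g b)

theorem ex_cons (f : List ℕ+ → B) (k : ℕ+) (x : H1) :
    ex f (cons k x) = ex (fun w => f (k :: w)) x :=
  lin_ext (f := (ex f).comp (cons k)) (fun w => by simp [cons_W, ex_W]) x

theorem conv_cons (f g : List ℕ+ → B) (k : ℕ+) (x : H1) :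
    ex (conv f g) (cons k x) = f [] * ex g (cons k x) + ex (conv (fun w => f (k :: w)) g) x := by
  have := lin_ext (f := (ex (conv f g)).comp (cons k))
    (g := (LinearMap.mulLeft ℚ (f [])).comp ((ex g).comp (cons k)) +
      ex (conv (fun w => f (k :: w)) g))
    (fun w => by simp [cons_W, ex_W, conv, ssum]) x
  simpa using this

theorem conv_harmW : ∀ (u v : List ℕ+) (f g : List ℕ+ → B), ex (conv f g) (harmW u v) =
    ssum u fun a b => ssum v fun c d => ex f (harmW a c) * ex g (harmW b d)
  | [], v, f, g => by simp [ssum, harmW_nil_left, ex_W, conv]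
  | u, [], f, g => by simp [ssum, harmW_nil_right, ex_W, conv]
  | k :: u, l :: v, f, g => by
    have e : ex (conv f g) (harmW (k :: u) (l :: v)) = f [] * ex g (harmW (k :: u) (l :: v))
        + ex (conv (fun w => f (k :: w)) g) (harmW u (l :: v))
        + ex (conv (fun w => f (l :: w)) g) (harmW (k :: u) v)
        + ex (conv (fun w => f ((k + l) :: w)) g) (harmW u v) := by
      rw [harmW_cons]
      simp only [map_add, conv_cons]
      ring
    rw [e, conv_harmW u (l :: v), conv_harmW (k :: u) v, conv_harmW u v]
    simp only [ssum, harmW_cons, harmW_nil_left, harmW_nil_right, ex_W, map_add, ex_cons,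
      ssum_add, add_mul, mul_add]
    ring
  termination_by u v => u.length + v.length

theorem conv_mul (f g : List ℕ+ → B) (hf : ∀ u v, ex f (harmW u v) = f u * f v)
    (hg : ∀ u v, ex g (harmW u v) = g u * g v) (u v : List ℕ+) :
    ex (conv f g) (harmW u v) = conv f g u * conv f g v := by
  rw [conv_harmW]
  simp only [hf, hg, conv, ssum_range, Finset.sum_mul_sum]
  refine Finset.sum_congr rfl fun i _ => Finset.sum_congr rfl fun j _ => ?_
  ring

end conv

/-! The ring -/

/-- `H¹` with the harmonic product -/
def QS : Type := H1

noncomputable instance : AddCommGroup QS := inferInstanceAs (AddCommGroup H1)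
noncomputable instance : Module ℚ QS := inferInstanceAs (Module ℚ H1)
noncomputable instance : CommRing QS :=
  { (inferInstance : AddCommGroup QS) with
    mul := fun x y => mu x y
    one := W []
    mul_assoc := mu_assoc
    mul_comm := mu_comm
    one_mul := one_mu
    mul_one := mu_one
    left_distrib := fun a b c => (mu a).map_add b c
    right_distrib := fun a b c => by
      exact LinearMap.map_add₂ mu a b c
    zero_mul := fun a => LinearMap.map_zero₂ mu a
    mul_zero := fun a => (mu a).map_zero
    zsmul := (inferInstance : AddCommGroup QS).zsmul
    nsmul := (inferInstance : AddCommGroup QS).nsmul }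
noncomputable instance : Algebra ℚ QS := Algebra.ofModule
  (fun r x y => LinearMap.map_smul₂ mu r x y)
  (fun r x y => (mu x).map_smul r y)

/-- conversion -/
def toQ (x : H1) : QS := x

theorem mul_def (x y : H1) : toQ x * toQ y = toQ (mu x y) := rfl

/-- the power series associated to a family of linear maps -/
noncomputable def ser (F : ℕ → (H1 →ₗ[ℚ] H1)) : H1 →ₗ[ℚ] PowerSeries QS where
  toFun x := PowerSeries.mk fun m => toQ (F m x)
  map_add' x y := by ext m; simp; rfl
  map_smul' c x := by
    ext m
    rw [PowerSeries.coeff_mk, map_smul]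
    change _ = c • PowerSeries.coeff m (PowerSeries.mk fun m => toQ (F m x))
    rw [PowerSeries.coeff_mk]
    rfl

theorem ex_ser (F : ℕ → (H1 →ₗ[ℚ] H1)) (x : H1) : ex (fun w => ser F (W w)) x = ser F x :=
  lin_ext (fun w => by rw [ex_W]) x

theorem ser_mul (F : ℕ → (H1 →ₗ[ℚ] H1)) (h : ∀ m x y, F m (mu x y) =
    ∑ p ∈ Finset.HasAntidiagonal.antidiagonal m, mu (F p.1 x) (F p.2 y)) (u v : List ℕ+) :
    ex (fun w => ser F (W w)) (harmW u v) = ser F (W u) * ser F (W v) := by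
  rw [ex_ser, ← mu_W]
  ext m
  rw [PowerSeries.coeff_mul]
  simp only [ser, LinearMap.coe_mk, AddHom.coe_mk, PowerSeries.coeff_mk, h, mul_def]
  rfl

/-- the identity, as a family -/
noncomputable def F0 (m : ℕ) : H1 →ₗ[ℚ] H1 := if m = 0 then LinearMap.id else 0
/-- `S̃ σ_m rev`, as a family -/
noncomputable def F1 (m : ℕ) : H1 →ₗ[ℚ] H1 := SL.comp ((sg m).comp rv)

theorem F0_mul (m : ℕ) (x y : H1) : F0 m (mu x y) =
    ∑ p ∈ Finset.HasAntidiagonal.antidiagonal m, mu (F0 p.1 x) (F0 p.2 y) := by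
  rw [Finset.sum_eq_single (0, m)]
  · by_cases h : m = 0 <;> simp [F0, h]
  · rintro ⟨i, j⟩ h hne
    have : i ≠ 0 := by
      rintro rfl
      simp at h; simp [h] at hne
    simp [F0, this]
  · simp

theorem F1_mul (m : ℕ) (x y : H1) : F1 m (mu x y) =
    ∑ p ∈ Finset.HasAntidiagonal.antidiagonal m, mu (F1 p.1 x) (F1 p.2 y) := by
  simp [F1, rv_mu, sg_mu, SL_mu]

/-- `λ` on words with values in power series -/
noncomputable def Lam : List ℕ+ → PowerSeries QS :=
  conv (fun w => ser F0 (W w)) (fun w => ser F1 (W w))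

theorem Lam_mul (x y : H1) : ex Lam (mu x y) = ex Lam x * ex Lam y := by
  have := bilin_ext (f := mu.compr₂ (ex Lam))
    (g := (LinearMap.mul ℚ (PowerSeries QS)).compl₁₂ (ex Lam) (ex Lam))
    (fun u v => by
      simp only [LinearMap.compr₂_apply, LinearMap.compl₁₂_apply, LinearMap.mul_apply', mu_W, ex_W]
      exact conv_mul _ _ (ser_mul F0 F0_mul) (ser_mul F1 F1_mul) u v) x y
  simpa using this

theorem coeff_Lam (w : List ℕ+) (m : ℕ) : PowerSeries.coeff m (Lam w) = toQ (lamW w m) := by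
  rw [Lam, conv, ssum_range, map_sum, lamW]
  refine Finset.sum_congr rfl fun i _ => ?_
  rw [PowerSeries.coeff_mul, Finset.sum_eq_single (0, m)]
  · simp only [ser, LinearMap.coe_mk, AddHom.coe_mk, PowerSeries.coeff_mk, mul_def, harm_eq]
    simp [F0, F1, rv, ex_W, sg, Stt_eq]
    rfl
  · rintro ⟨i, j⟩ h hne
    have : i ≠ 0 := by
      rintro rfl
      simp at h; simp [h] at hne
    simp only [ser, LinearMap.coe_mk, AddHom.coe_mk, PowerSeries.coeff_mk, mul_def]
    simp [F0, this]
    rfl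
  · simp

/-- coefficient as a rational linear map -/
noncomputable def cof (m : ℕ) : PowerSeries QS →ₗ[ℚ] QS where
  toFun p := PowerSeries.coeff m p
  map_add' x y := rfl
  map_smul' c x := rfl

theorem coeff_ex_Lam (x : H1) (m : ℕ) : PowerSeries.coeff m (ex Lam x) = toQ (lam x m) :=
  lin_ext (f := (cof m).comp (ex Lam)) (g := ex (M := QS) (fun w => toQ (lamW w m)))
    (fun w => by
      rw [LinearMap.comp_apply, ex_W, ex_W]
      exact coeff_Lam w m) x

end LamHom

/-- `λ` is a homomorphism for the harmonic product,
`λ(u ∗ v) = λ(u) ∗ λ(v)` (coefficientwise in `α`). -/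
theorem lam_harm_hom (u v : H1) (m : ℕ) :
    lam (harm u v) m = ∑ i ∈ Finset.range (m + 1), harm (lam u i) (lam v (m - i)) := by
  have h : LamHom.toQ (lam (LamHom.mu u v) m) = ∑ p ∈ Finset.HasAntidiagonal.antidiagonal m, LamHom.toQ (lam u p.1) * LamHom.toQ (lam v p.2) := by
    rw [← LamHom.coeff_ex_Lam, LamHom.Lam_mul, PowerSeries.coeff_mul]
    simp only [LamHom.coeff_ex_Lam]
  simp only [LamHom.harm_eq]
  rw [← Finset.Nat.sum_antidiagonal_eq_sum_range_succ (fun i j => LamHom.mu (lam u i) (lam v j))]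
  exact h
end

section
/- The kernel of ψ is contained in yH ∗ yH: every w ∈ yH with ψ(w) = 0 lies in the ℚ-linear span of the elements w₁ ∗ w₂ with w₁, w₂ ∈ yH. -/
open scoped BigOperators

namespace PsiKer

theorem h1_ind {p : H1 → Prop} (h : H1) (h0 : p 0) (ha : ∀ a b, p a → p b → p (a + b))
    (hs : ∀ (c : ℚ) a, p a → p (c • a)) (hw : ∀ w, p (W w)) : p h := by
  induction h using Finsupp.induction_linear with
  | zero => exact h0
  | add f g hf hg => exact ha _ _ hf hg
  | single w c =>
    have : (Finsupp.single w c : H1) = c • W w := by simp [W]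
    rw [this]; exact hs _ _ (hw w)

theorem lext {M : Type*} [AddCommGroup M] [Module ℚ M] {F G : H1 →ₗ[ℚ] M}
    (h : ∀ w, F (W w) = G (W w)) : F = G := by
  ext x
  simpa [W] using h x

/-- Linear map with prescribed values on words. -/
noncomputable def lin {M : Type*} [AddCommGroup M] [Module ℚ M] (f : List ℕ+ → M) :
    H1 →ₗ[ℚ] M := Finsupp.linearCombination ℚ f

@[simp] theorem lin_W {M : Type*} [AddCommGroup M] [Module ℚ M] (f : List ℕ+ → M) (w) :
    lin f (W w) = f w := by simp [lin, W]

theorem lin_apply {M : Type*} [AddCommGroup M] [Module ℚ M] (f : List ℕ+ → M) (h : H1) :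
    lin f h = h.sum fun w c => c • f w := by simp [lin, Finsupp.linearCombination_apply]

noncomputable def cL (k : ℕ+) : H1 →ₗ[ℚ] H1 := Finsupp.lmapDomain ℚ ℚ (fun w => k :: w)

theorem consL_eq (k h) : consL k h = cL k h := rfl

theorem cL_W (k w) : cL k (W w) = W (k :: w) := by simp [cL, W]

noncomputable def mL : H1 →ₗ[ℚ] H1 →ₗ[ℚ] H1 := lin (fun u => lin (harmW u))

theorem harm_eq (g h) : harm g h = mL g h := by
  simp only [mL, lin_apply, harm]
  simp only [Finsupp.sum, LinearMap.sum_apply, LinearMap.smul_apply, lin_apply, Finset.smul_sum, smul_smul]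

theorem mL_W (u v) : mL (W u) (W v) = harmW u v := by simp [mL]

@[simp] theorem mL_one_left (x) : mL (W []) x = x := by
  have : mL (W []) = LinearMap.id := lext fun w => by simp [mL, harmW]
  simp [this]

@[simp] theorem mL_one_right (x) : mL x (W []) = x := by
  have : mL.flip (W []) = LinearMap.id := lext fun w => by
    cases w <;> simp [mL, harmW]
  simpa using congrArg (fun f => f x) this

theorem mL_cons (k l a b) : mL (cL k a) (cL l b) =
    cL k (mL a (cL l b)) + cL l (mL (cL k a) b) + cL (k + l) (mL a b) := by
  induction a using h1_ind with
  | h0 => simp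
  | ha a b h1 h2 => simp only [map_add, LinearMap.add_apply, h1, h2]; abel
  | hs c a h => simp only [map_smul, LinearMap.smul_apply, h]; simp only [smul_add]
  | hw u =>
    induction b using h1_ind with
    | h0 => simp
    | ha a b h1 h2 => simp only [map_add, h1, h2]; abel
    | hs c a h => simp only [map_smul, h]; simp only [smul_add]
    | hw v =>
      simp only [cL_W, mL_W]
      rw [harmW]
      simp only [consL_eq]

theorem mL_comm_W (u v) : mL (W u) (W v) = mL (W v) (W u) := by
  induction u generalizing v with
  | nil => simp
  | cons k u ih =>
    induction v with
    | nil => simp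
    | cons l v ih2 =>
      simp only [← cL_W] at *
      have e := ih (l :: v)
      rw [← cL_W] at e
      rw [mL_cons, mL_cons, ih2, ih v, add_comm l k, e]
      abel

theorem mL_comm (x y) : mL x y = mL y x := by
  have : mL = mL.flip := lext fun u => lext fun v => by simpa using mL_comm_W u v
  exact congrArg (fun f => f x y) this

theorem mL_assoc_W (u v w) : mL (mL (W u) (W v)) (W w) = mL (W u) (mL (W v) (W w)) := by
  induction u generalizing v w with
  | nil => simp
  | cons k u ihu =>
    induction v generalizing w with
    | nil => simp
    | cons l v ihv =>
      induction w with
      | nil => simp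
      | cons m w ihw =>
        have e1 := ihu (l :: v) (m :: w)
        have e2 := ihu (l :: v) w
        have e3 := ihu v (m :: w)
        have e4 := ihu v w
        have e5 := ihv (m :: w)
        have e6 := ihv w
        simp only [← cL_W] at *
        simp only [mL_cons, map_add, LinearMap.add_apply] at *
        simp only [e1, e2, e3, e4, e5, e6, add_assoc, map_add]
        have h3 := congrArg (cL m) ihw
        simp only [map_add] at h3
        linear_combination (norm := module) (1 : ℚ) • h3

theorem mL_assoc (x y z) : mL (mL x y) z = mL x (mL y z) := by
  induction x using h1_ind with
  | h0 => simp
  | ha a b h1 h2 => simp only [map_add, LinearMap.add_apply, h1, h2]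
  | hs c a h => simp only [map_smul, LinearMap.smul_apply, h]
  | hw u =>
    induction y using h1_ind with
    | h0 => simp
    | ha a b h1 h2 => simp only [map_add, LinearMap.add_apply, h1, h2]
    | hs c a h => simp only [map_smul, LinearMap.smul_apply, h]
    | hw v =>
      induction z using h1_ind with
      | h0 => simp
      | ha a b h1 h2 => simp only [map_add, h1, h2]
      | hs c a h => simp only [map_smul, h]
      | hw w => exact mL_assoc_W u v w

theorem mL_left_comm (x y z) : mL x (mL y z) = mL y (mL x z) := by
  rw [← mL_assoc, mL_comm x y, mL_assoc]

/-! Convolution -/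

noncomputable def convW : List ℕ+ → (H1 →ₗ[ℚ] H1) → (H1 →ₗ[ℚ] H1) → H1
  | [], F, G => mL (F (W [])) (G (W []))
  | k :: w, F, G => mL (F (W [])) (G (W (k :: w))) + convW w (F ∘ₗ cL k) G

noncomputable def conv (F G : H1 →ₗ[ℚ] H1) : H1 →ₗ[ℚ] H1 := lin (fun w => convW w F G)

@[simp] theorem conv_nil (F G) : conv F G (W []) = mL (F (W [])) (G (W [])) := by
  simp [conv, convW]

theorem conv_cons (F G k h) :
    conv F G (cL k h) = mL (F (W [])) (G (cL k h)) + conv (F ∘ₗ cL k) G h := by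
  have : conv F G ∘ₗ cL k = mL (F (W [])) ∘ₗ G ∘ₗ cL k + conv (F ∘ₗ cL k) G :=
    lext fun w => by simp [conv, cL_W, convW]
  exact congrArg (fun f => f h) this

theorem conv_add_left (F F' G) : conv (F + F') G = conv F G + conv F' G := by
  refine lext fun w => ?_
  induction w generalizing F F' with
  | nil => simp
  | cons k w ih =>
    rw [LinearMap.add_apply, ← cL_W]
    simp only [conv_cons, LinearMap.add_comp, ih, LinearMap.add_apply, map_add]
    abel

theorem conv_smul_left (c : ℚ) (F G) : conv (c • F) G = c • conv F G := by
  refine lext fun w => ?_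
  induction w generalizing F with
  | nil => simp
  | cons k w ih =>
    rw [LinearMap.smul_apply, ← cL_W]
    simp only [conv_cons, LinearMap.smul_comp, ih, LinearMap.smul_apply, map_smul, smul_add]

theorem conv_add_right (F G G') : conv F (G + G') = conv F G + conv F G' := by
  refine lext fun w => ?_
  induction w generalizing F with
  | nil => simp
  | cons k w ih =>
    rw [LinearMap.add_apply, ← cL_W]
    simp only [conv_cons, ih, LinearMap.add_apply, map_add]
    abel

theorem conv_neg_left (F G) : conv (-F) G = - conv F G := by
  rw [eq_neg_iff_add_eq_zero, ← conv_add_left, neg_add_cancel]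
  simpa using conv_smul_left 0 0 G

theorem conv_mL_left (c : H1) (F G) : conv (mL c ∘ₗ F) G = mL c ∘ₗ conv F G := by
  refine lext fun w => ?_
  induction w generalizing F with
  | nil => simp [mL_assoc]
  | cons k w ih =>
    rw [LinearMap.comp_apply, ← cL_W]
    simp only [conv_cons, LinearMap.comp_assoc, ih, LinearMap.comp_apply, map_add, mL_assoc]

theorem conv_assoc (F G K) : conv (conv F G) K = conv F (conv G K) := by
  refine lext fun w => ?_
  induction w generalizing F with
  | nil => simp [mL_assoc]
  | cons k w ih =>
    have e : conv F G ∘ₗ cL k = mL (F (W [])) ∘ₗ (G ∘ₗ cL k) + conv (F ∘ₗ cL k) G :=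
      LinearMap.ext fun h => by simp [conv_cons]
    rw [← cL_W]
    rw [conv_cons, e, conv_add_left, conv_mL_left, LinearMap.add_apply, ih, conv_cons, conv_cons]
    simp [mL_assoc, add_assoc]

theorem conv_cancel (F) (h : conv F LinearMap.id = 0) : F = 0 := by
  refine lext fun w => ?_
  induction w generalizing F with
  | nil => simpa using congrArg (fun f => f (W [])) h
  | cons k w ih =>
    have h1 : F (W []) = 0 := by simpa using congrArg (fun f => f (W [])) h
    have := ih (F ∘ₗ cL k) (LinearMap.ext fun x => by
      have := congrArg (fun f => f (cL k x)) h
      simpa [conv_cons, h1] using this)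
    simpa [cL_W] using this

/-- counit -/
noncomputable def eps : H1 →ₗ[ℚ] H1 := lin (fun w => match w with | [] => W [] | _ :: _ => 0)

@[simp] theorem eps_nil : eps (W []) = W [] := by simp [eps]
@[simp] theorem eps_cons (k h) : eps (cL k h) = 0 := by
  have : eps ∘ₗ cL k = 0 := lext fun w => by simp [cL_W, eps]
  exact congrArg (fun f => f h) this
theorem eps_cons' (k) : eps ∘ₗ cL k = 0 := LinearMap.ext fun h => by simp

@[simp] theorem conv_zero_left (G) : conv 0 G = 0 := by
  simpa using conv_smul_left 0 0 G

theorem conv_eps_left (G) : conv eps G = G := by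
  refine lext fun w => ?_
  cases w with
  | nil => simp
  | cons k w => rw [← cL_W, conv_cons, eps_cons']; simp

theorem conv_eps_right (F) : conv F eps = F := by
  refine lext fun w => ?_
  induction w generalizing F with
  | nil => simp
  | cons k w ih => rw [← cL_W, conv_cons, ih]; simp

theorem convW_sum (F G w) : conv F G (W w) =
    ∑ i ∈ Finset.range (w.length + 1), mL (F (W (w.take i))) (G (W (w.drop i))) := by
  induction w generalizing F with
  | nil => simp
  | cons k w ih =>
    rw [← cL_W, conv_cons, ih, List.length_cons, Finset.sum_range_succ' _ (w.length + 1)]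
    simp [cL_W, add_comm]

/-! The derivations -/

noncomputable def DW (e : ℕ) : List ℕ+ → H1
  | [] => 0
  | k :: w => ((k : ℕ) : ℚ) • W (pplus k e :: w) + cL k (DW e w)

noncomputable def Dd (e : ℕ) : H1 →ₗ[ℚ] H1 := lin (DW e)

@[simp] theorem Dd_nil (e) : Dd e (W []) = 0 := by simp [Dd, DW]

theorem Dd_cons (e k h) : Dd e (cL k h) = ((k : ℕ) : ℚ) • cL (pplus k e) h + cL k (Dd e h) := by
  have : Dd e ∘ₗ cL k = ((k : ℕ) : ℚ) • cL (pplus k e) + cL k ∘ₗ Dd e :=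
    lext fun w => by simp [cL_W, Dd, DW]
  exact congrArg (fun f => f h) this

theorem pplus_coe (k e) : ((pplus k e : ℕ+) : ℕ) = k + e := rfl

theorem pplus_add_left (k l e) : pplus k e + l = pplus (k + l) e := by
  apply PNat.eq; simp only [PNat.add_coe, pplus_coe]; ring
theorem pplus_add_right (k l e) : k + pplus l e = pplus (k + l) e := by
  apply PNat.eq; simp only [PNat.add_coe, pplus_coe]; ring

theorem Dd_mul_W (e u v) : Dd e (mL (W u) (W v)) =
    mL (Dd e (W u)) (W v) + mL (W u) (Dd e (W v)) := by
  induction u generalizing v with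
  | nil => simp
  | cons k u ihu =>
    induction v with
    | nil => simp
    | cons l v ihv =>
      have e1 := ihu (l :: v)
      have e2 := ihu v
      simp only [← cL_W] at *
      simp only [mL_cons, map_add, LinearMap.add_apply, Dd_cons, map_smul, LinearMap.smul_apply,
        pplus_add_left, pplus_add_right] at *
      simp only [e1, e2, ihv, map_add, map_smul, smul_add]
      push_cast
      module

theorem Dd_mul (e x y) : Dd e (mL x y) = mL (Dd e x) y + mL x (Dd e y) := by
  induction x using h1_ind with
  | h0 => simp
  | ha a b h1 h2 => simp only [map_add, LinearMap.add_apply, h1, h2]; abel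
  | hs c a h => simp only [map_smul, LinearMap.smul_apply, h, smul_add]
  | hw u =>
    induction y using h1_ind with
    | h0 => simp
    | ha a b h1 h2 => simp only [map_add, h1, h2]; abel
    | hs c a h => simp only [map_smul, h, smul_add]
    | hw v => exact Dd_mul_W e u v

theorem Dd_conv (e F G) : Dd e ∘ₗ conv F G = conv (Dd e ∘ₗ F) G + conv F (Dd e ∘ₗ G) := by
  refine lext fun w => ?_
  simp only [LinearMap.comp_apply, LinearMap.add_apply, convW_sum, map_sum, Dd_mul,
    Finset.sum_add_distrib]

theorem conv_Dd (e F G) : conv F G ∘ₗ Dd e = conv (F ∘ₗ Dd e) G + conv F (G ∘ₗ Dd e) := by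
  refine lext fun w => ?_
  induction w generalizing F with
  | nil => simp
  | cons k w ih =>
    have h : (F ∘ₗ Dd e) ∘ₗ cL k = ((k : ℕ) : ℚ) • (F ∘ₗ cL (pplus k e)) + (F ∘ₗ cL k) ∘ₗ Dd e :=
      LinearMap.ext fun x => by simp [Dd_cons]
    have i := ih (F ∘ₗ cL k)
    simp only [LinearMap.comp_apply, LinearMap.add_apply] at i
    simp only [← cL_W, LinearMap.comp_apply, LinearMap.add_apply, Dd_cons, map_add, map_smul,
      conv_cons, h, conv_add_left, conv_smul_left, i, LinearMap.smul_apply, Dd_nil, map_zero,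
      LinearMap.zero_apply, zero_add, smul_add]
    abel

theorem Dd_comm : Dd 0 ∘ₗ Dd 1 = Dd 1 ∘ₗ Dd 0 + Dd 1 := by
  refine lext fun w => ?_
  induction w with
  | nil => simp
  | cons k w ih =>
    simp only [LinearMap.comp_apply, LinearMap.add_apply] at ih ⊢
    have p0 : ∀ k, pplus k 0 = k := fun k => PNat.eq (by simp [pplus])
    have p1 : ((pplus k 1 : ℕ) : ℚ) = (k : ℕ) + 1 := by simp [pplus]
    simp only [← cL_W, Dd_cons, map_add, map_smul, ih, p0, p1]
    module

/-! Antipode -/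

theorem W_cons_mem (k w) : W (k :: w) ∈ yH1 := Submodule.subset_span ⟨k, w, rfl⟩

theorem cL_mem (k h) : cL k h ∈ yH1 := by
  induction h using h1_ind with
  | h0 => simp
  | ha a b h1 h2 => rw [map_add]; exact add_mem h1 h2
  | hs c a h => rw [map_smul]; exact Submodule.smul_mem _ _ h
  | hw w => rw [cL_W]; exact W_cons_mem k w

theorem y_ind {p : (h : H1) → h ∈ yH1 → Prop} {h : H1} (hh : h ∈ yH1) (h0 : p 0 (zero_mem _))
    (ha : ∀ a b (h1 : a ∈ yH1) (h2 : b ∈ yH1), p a h1 → p b h2 → p (a + b) (add_mem h1 h2))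
    (hs : ∀ (c : ℚ) a (h1 : a ∈ yH1), p a h1 → p (c • a) (Submodule.smul_mem _ c h1))
    (hw : ∀ k w, p (cL k (W w)) (cL_mem _ _)) : p h hh := by
  refine Submodule.span_induction (p := p) ?_ h0 ha hs hh
  rintro x ⟨k, ks, rfl⟩
  have := hw k ks
  simp only [cL_W] at this
  exact this

theorem StW_mem (l p) : StW (l :: p) ∈ yH1 := by
  induction p generalizing l with
  | nil => simp only [StW]; exact W_cons_mem _ _
  | cons m p ih => simp only [StW, consL_eq]; exact add_mem (cL_mem _ _) (ih _)

noncomputable def Bf (x : H1) : H1 →ₗ[ℚ] H1 :=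
  lin (fun w => match w with | [] => 0 | l :: w => cL l (mL (W w) x))

theorem Bf_cons (x l h) : Bf x (cL l h) = cL l (mL h x) := by
  have : Bf x ∘ₗ cL l = cL l ∘ₗ mL.flip x := lext fun w => by simp [cL_W, Bf]
  exact congrArg (fun f => f h) this

noncomputable def shf (k : ℕ+) : H1 →ₗ[ℚ] H1 :=
  lin (fun w => match w with | [] => 0 | l :: w => W ((k + l) :: w))

theorem shf_cons (k l h) : shf k (cL l h) = cL (k + l) h := by
  have : shf k ∘ₗ cL l = cL (k + l) := lext fun w => by simp [cL_W, shf]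
  exact congrArg (fun f => f h) this

theorem shf_StW (k l p) : shf k (StW (l :: p)) = StW ((k + l) :: p) := by
  induction p generalizing l with
  | nil => simp only [StW, ← cL_W, shf_cons]
  | cons m p ih => simp only [StW, consL_eq, map_add, shf_cons, ih, add_assoc]

theorem Bf_nil {y} (hy : y ∈ yH1) : Bf (W []) y = y := by
  induction hy using y_ind with
  | h0 => simp
  | ha a b _ _ h1 h2 => rw [map_add, h1, h2]
  | hs c a _ h => rw [map_smul, h]
  | hw k w => simp [Bf_cons]

theorem mL_Bf {y} (hy : y ∈ yH1) (k x) :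
    mL y (cL k x) = Bf (cL k x) y + cL k (mL y x) + Bf x (shf k y) := by
  induction hy using y_ind with
  | h0 => simp
  | ha a b _ _ h1 h2 => simp only [map_add, LinearMap.add_apply, h1, h2]; abel
  | hs c a _ h => simp only [map_smul, LinearMap.smul_apply, h, smul_add]
  | hw l w => simp only [Bf_cons, shf_cons, mL_cons, add_comm k l]

noncomputable def AF (p : List ℕ+) : H1 →ₗ[ℚ] H1 :=
  lin (fun w => ((-1 : ℚ)) ^ w.length • StW (w.reverse ++ p))

theorem AF_cons (p k) : AF p ∘ₗ cL k = - AF (k :: p) :=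
  lext fun w => by simp [cL_W, AF, pow_succ]

theorem AF_conv (l p w) : conv (AF (l :: p)) LinearMap.id (W w) = Bf (W w) (StW (l :: p)) := by
  induction w generalizing l p with
  | nil => simp [Bf_nil (StW_mem l p), AF]
  | cons k w ih =>
    have e : AF (l :: p) (W []) = StW (l :: p) := by simp [AF]
    rw [← cL_W, conv_cons, AF_cons, conv_neg_left, LinearMap.neg_apply, ih, e, LinearMap.id_apply,
      mL_Bf (StW_mem l p), shf_StW]
    simp only [StW, consL_eq, map_add, Bf_cons]
    abel

/-- the antipode -/
noncomputable def anti : H1 →ₗ[ℚ] H1 := AF []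

@[simp] theorem anti_nil : anti (W []) = W [] := by simp [anti, AF, StW]

theorem anti_conv_id : conv anti LinearMap.id = eps := by
  refine lext fun w => ?_
  cases w with
  | nil => simp
  | cons k w =>
    rw [← cL_W, conv_cons, anti, AF_cons, conv_neg_left, LinearMap.neg_apply, AF_conv]
    have e : AF [] (W []) = W [] := anti_nil
    simp only [e, StW, ← cL_W, Bf_cons]
    simp

theorem id_conv_anti : conv LinearMap.id anti = eps := by
  rw [← sub_eq_zero]
  apply conv_cancel
  rw [sub_eq_add_neg, conv_add_left, conv_neg_left, conv_assoc, anti_conv_id, conv_eps_left,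
    conv_eps_right, add_neg_cancel]

theorem Dd_eps (e) : Dd e ∘ₗ eps = 0 := lext fun w => by
  cases w with
  | nil => simp
  | cons k w => simp [← cL_W]

theorem eps_Dd (e) : eps ∘ₗ Dd e = 0 := lext fun w => by
  cases w with
  | nil => simp
  | cons k w => simp [← cL_W, Dd_cons]

theorem anti_Dd (e) : anti ∘ₗ Dd e = Dd e ∘ₗ anti := by
  have h1 := Dd_conv e anti LinearMap.id
  have h2 := conv_Dd e anti LinearMap.id
  rw [anti_conv_id, Dd_eps] at h1
  rw [anti_conv_id, eps_Dd] at h2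
  rw [← sub_eq_zero]
  apply conv_cancel
  rw [sub_eq_add_neg, conv_add_left, conv_neg_left]
  simp only [LinearMap.comp_id, LinearMap.id_comp] at h1 h2
  rw [eq_comm, ← sub_eq_zero] at h1 h2
  linear_combination (norm := module) (1 : ℚ) • h2 - (1 : ℚ) • h1

noncomputable def Phi (e : ℕ) : H1 →ₗ[ℚ] H1 := conv LinearMap.id (anti ∘ₗ Dd e)

theorem Phi_conv_id (e) : conv (Phi e) LinearMap.id = - Dd e := by
  have h1 := Dd_conv e LinearMap.id anti
  rw [id_conv_anti, Dd_eps, ← anti_Dd, LinearMap.comp_id] at h1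
  have h2 : Phi e = - conv (Dd e) anti := (neg_eq_of_add_eq_zero_right h1.symm).symm
  rw [h2, conv_neg_left, conv_assoc, anti_conv_id, conv_eps_right]

theorem Phi_comm : Phi 0 ∘ₗ Dd 1 = Dd 1 ∘ₗ Phi 0 + Phi 1 := by
  unfold Phi
  rw [conv_Dd, Dd_conv, LinearMap.comp_assoc, Dd_comm, LinearMap.comp_add, conv_add_right,
    ← LinearMap.comp_assoc, ← LinearMap.comp_assoc, anti_Dd 1]
  simp only [LinearMap.comp_id, LinearMap.id_comp, add_assoc]

/-! Multiplicativity of deconcatenation -/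

noncomputable def conv2 : List ℕ+ → (H1 →ₗ[ℚ] H1 →ₗ[ℚ] H1) → (H1 →ₗ[ℚ] H1 →ₗ[ℚ] H1) →
    (H1 →ₗ[ℚ] H1)
  | [], B, C => conv (B (W [])) (C (W []))
  | k :: u, B, C => conv (B (W [])) (C (W (k :: u))) + conv2 u (B ∘ₗ cL k) C

theorem conv2_add (u B B' C) : conv2 u (B + B') C = conv2 u B C + conv2 u B' C := by
  induction u generalizing B B' with
  | nil => simp [conv2, conv_add_left]
  | cons k u ih =>
    simp only [conv2, LinearMap.add_comp, ih, LinearMap.add_apply, conv_add_left]; abel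

theorem conv2_neg (u B C) : conv2 u (-B) C = - conv2 u B C := by
  induction u generalizing B with
  | nil => simp [conv2, conv_neg_left]
  | cons k u ih =>
    simp only [conv2, LinearMap.neg_comp, ih, LinearMap.neg_apply, conv_neg_left]; abel

theorem conv2_nil_right (u B C) :
    conv2 u B C (W []) = conv (B.flip (W [])) (C.flip (W [])) (W u) := by
  induction u generalizing B with
  | nil => simp [conv2]
  | cons k u ih =>
    rw [← cL_W, conv_cons, conv2, LinearMap.add_apply, ih, conv_nil, cL_W]
    rfl

theorem conv2_cons_right (u B C l h) :
    conv2 u B C (cL l h) = conv (B.flip (W [])) (C.flip (cL l h)) (W u)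
      + conv2 u (B.compl₂ (cL l)) C h := by
  induction u generalizing B with
  | nil => simp [conv2, conv_cons]; rfl
  | cons k u ih =>
    rw [conv2, LinearMap.add_apply, ih, conv_cons, ← cL_W, conv_cons, conv2, LinearMap.add_apply,
      cL_W]
    have e1 : (B ∘ₗ cL k).flip (W []) = B.flip (W []) ∘ₗ cL k := rfl
    have e2 : (B ∘ₗ cL k).compl₂ (cL l) = (B.compl₂ (cL l)) ∘ₗ cL k := rfl
    have e3 : B (W []) ∘ₗ cL l = (B.compl₂ (cL l)) (W []) := rfl
    rw [e1, e2, e3]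
    simp only [LinearMap.flip_apply]
    abel

theorem conv_mul (F G u v) : conv F G (mL (W u) (W v)) =
    conv2 u (mL.compr₂ F) (mL.compr₂ G) (W v) := by
  have one : ∀ F : H1 →ₗ[ℚ] H1, mL.compr₂ F (W []) = F := fun F =>
    LinearMap.ext fun x => by simp
  have one' : ∀ F : H1 →ₗ[ℚ] H1, (mL.compr₂ F).flip (W []) = F := fun F =>
    LinearMap.ext fun x => by simp
  induction u generalizing v F with
  | nil => simp [conv2, one]
  | cons k u ihu =>
    induction v generalizing F with
    | nil => rw [conv2_nil_right, one', one', mL_one_right]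
    | cons l v ihv =>
      have i1 := ihu (F ∘ₗ cL k) (l :: v)
      have i2 := ihv (F ∘ₗ cL l)
      have i3 := ihu (F ∘ₗ cL (k + l)) v
      rw [← cL_W, conv2_cons_right, one'] at i1
      rw [conv2, LinearMap.add_apply, one] at i2
      have e1 : (mL.compr₂ F ∘ₗ cL k).flip (W []) = F ∘ₗ cL k := LinearMap.ext fun x => by simp
      have e2 : (mL.compr₂ F ∘ₗ cL k).compl₂ (cL l) = (mL.compr₂ (F ∘ₗ cL k)).compl₂ (cL l)
          + (mL.compr₂ (F ∘ₗ cL l)) ∘ₗ cL k + mL.compr₂ (F ∘ₗ cL (k + l)) :=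
        LinearMap.ext fun x => LinearMap.ext fun y => by simp [mL_cons]
      rw [conv2, LinearMap.add_apply, one, ← cL_W l v, conv_cons, conv2_cons_right, e1, e2,
        conv2_add, conv2_add, LinearMap.add_apply, LinearMap.add_apply, ← i3, ← cL_W k u, mL_cons,
        map_add, map_add, conv_cons, conv_cons, conv_cons, i1, cL_W k u, i2]
      simp only [LinearMap.compr₂_apply, ← cL_W, mL_cons, map_add]
      abel

theorem conv_mL_right (c : H1) (F G) : conv F (mL c ∘ₗ G) = mL c ∘ₗ conv F G := by
  refine lext fun w => ?_
  simp only [convW_sum, LinearMap.comp_apply, map_sum]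
  exact Finset.sum_congr rfl fun i _ => mL_left_comm _ _ _

theorem conv2_tensor (F G F' G') (u x) :
    conv2 u (mL.compl₁₂ F G) (mL.compl₁₂ F' G') x = mL (conv F F' (W u)) (conv G G' x) := by
  have e : ∀ (F G : H1 →ₗ[ℚ] H1) x, mL.compl₁₂ F G x = mL (F x) ∘ₗ G := fun _ _ _ => rfl
  induction u generalizing F with
  | nil => simp [conv2, e, conv_mL_left, conv_mL_right, mL_assoc, mL_left_comm (F' (W []))]
  | cons k u ih =>
    have e2 : mL.compl₁₂ F G ∘ₗ cL k = mL.compl₁₂ (F ∘ₗ cL k) G := rfl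
    rw [conv2, LinearMap.add_apply, e2, ih, e, e, conv_mL_left, conv_mL_right, ← cL_W, conv_cons]
    simp [mL_assoc]

theorem conv2_cancel (B) (h : ∀ u, conv2 u B mL = 0) : B = 0 := by
  refine lext fun u => ?_
  induction u generalizing B with
  | nil =>
    apply conv_cancel
    have := h []
    have e : mL (W []) = LinearMap.id := LinearMap.ext fun x => by simp
    rwa [conv2, e] at this
  | cons k u ih =>
    have h1 : B (W []) = 0 := by
      apply conv_cancel
      have := h []
      have e : mL (W []) = LinearMap.id := LinearMap.ext fun x => by simp
      rwa [conv2, e] at this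
    have := ih (B ∘ₗ cL k) (fun u => by
      have := h (k :: u)
      simpa [conv2, h1] using this)
    simpa [cL_W] using this

theorem Phi_mul (e) : mL.compr₂ (Phi e) = mL.compl₁₂ (Phi e) eps + mL.compl₁₂ eps (Phi e) := by
  rw [← sub_eq_zero]
  apply conv2_cancel
  intro u
  refine lext fun v => ?_
  have h1 := conv_mul (Phi e) LinearMap.id u v
  have m1 : mL.compr₂ LinearMap.id = mL := rfl
  have h2 := conv2_tensor (Phi e) eps LinearMap.id LinearMap.id u (W v)
  have h3 := conv2_tensor eps (Phi e) LinearMap.id LinearMap.id u (W v)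
  have m2 : mL.compl₁₂ LinearMap.id LinearMap.id = mL := rfl
  rw [m2, Phi_conv_id, conv_eps_left] at h2 h3
  rw [m1, Phi_conv_id] at h1
  rw [sub_eq_add_neg, conv2_add, conv2_neg, conv2_add]
  simp only [LinearMap.add_apply, LinearMap.neg_apply, ← h1, h2, h3, Dd_mul]
  simp
  abel

theorem eps_y {x} (hx : x ∈ yH1) : eps x = 0 := by
  induction hx using y_ind with
  | h0 => simp
  | ha a b _ _ h1 h2 => simp [h1, h2]
  | hs c a _ h => simp [h]
  | hw k w => simp

theorem Phi_P (e x) (hx : x ∈ harmSpan) : Phi e x = 0 := by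
  refine Submodule.span_induction ?_ (map_zero _) (fun a b _ _ h1 h2 => by simp [h1, h2])
    (fun c a _ h => by simp [h]) hx
  rintro x ⟨u, hu, v, hv, rfl⟩
  have := congrArg (fun f => f u v) (Phi_mul e)
  simpa [eps_y hu, eps_y hv, harm_eq] using this

/-! Modulo products -/

theorem mL_P {x y} (hx : x ∈ yH1) (hy : y ∈ yH1) : mL x y ∈ harmSpan :=
  Submodule.subset_span ⟨x, hx, y, hy, (harm_eq _ _).symm⟩

theorem conv_P (F G : H1 →ₗ[ℚ] H1) (hF : ∀ w, F (W w) ∈ yH1) (hG : ∀ k w, G (W (k :: w)) ∈ yH1) (u) :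
    conv F G (W u) - mL (F (W u)) (G (W [])) ∈ harmSpan := by
  induction u generalizing F with
  | nil => simp
  | cons k u ih =>
    have := ih (F ∘ₗ cL k) (fun w => by simpa [cL_W] using hF _)
    rw [← cL_W, conv_cons, add_sub_assoc]
    refine add_mem (mL_P (hF _) ?_) this
    rw [cL_W]; exact hG _ _

theorem id_conv_P (G : H1 →ₗ[ℚ] H1) (hG : ∀ k w, G (W (k :: w)) ∈ yH1) {x} (hx : x ∈ yH1) :
    conv LinearMap.id G x - (G x + mL x (G (W []))) ∈ harmSpan := by
  induction hx using y_ind with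
  | h0 => simp
  | ha a b _ _ h1 h2 =>
    have := add_mem h1 h2
    simp only [map_add, LinearMap.add_apply]
    convert this using 1
    abel
  | hs c a _ h =>
    have := Submodule.smul_mem _ c h
    simp only [map_smul, LinearMap.smul_apply]
    convert this using 1
    simp only [smul_sub, smul_add]
  | hw k w =>
    have := conv_P (LinearMap.id ∘ₗ cL k) G (fun w => by simpa using cL_mem _ _) hG w
    rw [conv_cons]
    convert this using 1
    simp only [LinearMap.id_apply, mL_one_left, LinearMap.comp_apply]
    abel

theorem anti_y (k w) : anti (W (k :: w)) ∈ yH1 := by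
  have : ∃ l p, (k :: w).reverse = l :: p := by
    cases h : (k :: w).reverse with
    | nil => simp at h
    | cons l p => exact ⟨l, p, rfl⟩
  obtain ⟨l, p, h⟩ := this
  rw [anti, AF, lin_W, h, List.append_nil]
  exact Submodule.smul_mem _ _ (StW_mem _ _)

theorem map_y (G : H1 →ₗ[ℚ] H1) (hG : ∀ k w, G (W (k :: w)) ∈ yH1) {x} (hx : x ∈ yH1) :
    G x ∈ yH1 := by
  induction hx using y_ind with
  | h0 => simp
  | ha a b _ _ h1 h2 => rw [map_add]; exact add_mem h1 h2
  | hs c a _ h => rw [map_smul]; exact Submodule.smul_mem _ _ h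
  | hw k w => rw [cL_W]; exact hG k w

theorem Dd_y (e k w) : Dd e (W (k :: w)) ∈ yH1 := by
  rw [← cL_W, Dd_cons]
  exact add_mem (Submodule.smul_mem _ _ (cL_mem _ _)) (cL_mem _ _)

theorem anti_P {x} (hx : x ∈ yH1) (h : anti x ∈ harmSpan) : x ∈ harmSpan := by
  have := id_conv_P anti anti_y hx
  rw [id_conv_anti, eps_y hx, anti_nil, mL_one_right] at this
  have := neg_mem (add_mem this h)
  convert this using 1
  abel

theorem Dd_P (e) {x} (hx : x ∈ yH1) (h : Phi e x = 0) : Dd e x ∈ harmSpan := by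
  have := id_conv_P (anti ∘ₗ Dd e) (fun k w => map_y _ anti_y (Dd_y e k w)) hx
  rw [← Phi, h] at this
  apply anti_P (map_y _ (Dd_y e) hx)
  simpa using this

/-! Injectivity of the derivation -/

noncomputable def tl (k : ℕ+) : H1 →ₗ[ℚ] H1 :=
  lin (fun w => match w with | [] => 0 | l :: w => if l = k then W w else 0)

@[simp] theorem tl_nil (k) : tl k (W []) = 0 := by simp [tl]

theorem tl_cons (k l h) : tl k (cL l h) = if l = k then h else 0 := by
  have : tl k ∘ₗ cL l = if l = k then LinearMap.id else 0 := lext fun w => by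
    simp only [LinearMap.comp_apply, cL_W, tl, lin_W]; split_ifs <;> simp
  have := congrArg (fun f => f h) this
  simp only [LinearMap.comp_apply] at this
  rw [this]; split_ifs <;> simp

theorem tl_D (k) : tl (pplus k 1) ∘ₗ Dd 1 = Dd 1 ∘ₗ tl (pplus k 1) + ((k : ℕ) : ℚ) • tl k := by
  refine lext fun w => ?_
  cases w with
  | nil => simp
  | cons l w =>
    have hp : pplus l 1 = pplus k 1 ↔ l = k := by
      constructor
      · intro h
        have := congrArg PNat.val h
        apply PNat.eq
        change (l : ℕ) + 1 = k + 1 at this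
        omega
      · rintro rfl; rfl
    simp only [← cL_W, LinearMap.comp_apply, LinearMap.add_apply, LinearMap.smul_apply, Dd_cons,
      map_add, map_smul, tl_cons, hp]
    by_cases h : l = k
    · subst h; split_ifs <;> simp [add_comm]
    · by_cases h2 : l = pplus k 1
      · rw [if_neg h, if_pos h2, if_pos h2]; simp
      · simp [h, h2]

theorem tl_fin (x : H1) : ∃ K : ℕ, ∀ k : ℕ+, K ≤ k → tl k x = 0 := by
  induction x using h1_ind with
  | h0 => exact ⟨0, by simp⟩
  | ha a b h1 h2 =>
    obtain ⟨K, hK⟩ := h1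
    obtain ⟨M, hM⟩ := h2
    exact ⟨max K M, fun k hk => by
      rw [map_add, hK k (le_trans (le_max_left _ _) hk), hM k (le_trans (le_max_right _ _) hk),
        add_zero]⟩
  | hs c a h =>
    obtain ⟨K, hK⟩ := h
    exact ⟨K, fun k hk => by rw [map_smul, hK k hk, smul_zero]⟩
  | hw w =>
    cases w with
    | nil => exact ⟨0, by simp⟩
    | cons l w =>
      refine ⟨l + 1, fun k hk => ?_⟩
      rw [← cL_W, tl_cons, if_neg]
      rintro rfl
      omega

theorem tl_apply (k w) (x : H1) : tl k x w = x (k :: w) := by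
  induction x using h1_ind with
  | h0 => simp
  | ha a b h1 h2 => simp [h1, h2]
  | hs c a h => simp [h]
  | hw u =>
    cases u with
    | nil => rw [tl_nil]; simp [W]
    | cons l u =>
      rw [← cL_W, tl_cons, cL_W]
      by_cases h : l = k <;> simp [h, W, Finsupp.single_apply]

theorem y_nil {x} (hx : x ∈ yH1) : x [] = 0 := by
  induction hx using y_ind with
  | h0 => simp
  | ha a b _ _ h1 h2 => simp [h1, h2]
  | hs c a _ h => simp [h]
  | hw k w => rw [cL_W]; simp [W]

theorem D_inj {x} (hx : x ∈ yH1) (h : Dd 1 x = 0) : x = 0 := by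
  obtain ⟨K, hK⟩ := tl_fin x
  have step : ∀ k : ℕ+, tl (pplus k 1) x = 0 → tl k x = 0 := fun k hk => by
    have := congrArg (fun f => f x) (tl_D k)
    simp only [LinearMap.comp_apply, LinearMap.add_apply, LinearMap.smul_apply, h, hk, map_zero,
      zero_add] at this
    have hk0 : ((k : ℕ) : ℚ) ≠ 0 := by have := k.pos; positivity
    exact (smul_eq_zero.1 this.symm).resolve_left hk0
  have all : ∀ n : ℕ, ∀ k : ℕ+, K ≤ k + n → tl k x = 0 := by
    intro n
    induction n with
    | zero => exact fun k hk => hK k (by simpa using hk)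
    | succ n ih => exact fun k hk => step k (ih _ (by
        change K ≤ (k : ℕ) + 1 + n
        omega))
  ext w
  cases w with
  | nil => simpa using y_nil hx
  | cons k w => rw [← tl_apply, all K k (by omega)]; simp

/-! Weight -/

def wt (w : List ℕ+) : ℕ := (w.map (fun k : ℕ+ => (k : ℕ))).sum

theorem Y_W (w) : Dd 0 (W w) = (wt w : ℚ) • W w := by
  induction w with
  | nil => simp [wt]
  | cons k w ih =>
    have p0 : pplus k 0 = k := PNat.eq (by simp [pplus])
    rw [← cL_W, Dd_cons, ih, p0, map_smul, ← add_smul]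
    simp [wt]

noncomputable def Iw : H1 →ₗ[ℚ] H1 := lin (fun w => (wt w : ℚ)⁻¹ • W w)

theorem wt_ne (k w) : (wt (k :: w) : ℚ) ≠ 0 := by
  have := k.pos
  have : wt (k :: w) ≠ 0 := by simp [wt]
  exact_mod_cast this

theorem Iw_Y {x} (hx : x ∈ yH1) : Iw (Dd 0 x) = x := by
  induction hx using y_ind with
  | h0 => simp
  | ha a b _ _ h1 h2 => simp [h1, h2]
  | hs c a _ h => simp [h]
  | hw k w => simp [cL_W, Y_W, Iw, smul_smul, mul_inv_cancel₀ (wt_ne k w)]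

theorem mL_y (k u l v) : mL (W (k :: u)) (W (l :: v)) ∈ yH1 := by
  rw [← cL_W, ← cL_W, mL_cons]
  exact add_mem (add_mem (cL_mem _ _) (cL_mem _ _)) (cL_mem _ _)

theorem Iw_mul {x y} (hx : x ∈ yH1) (hy : y ∈ yH1) : Iw (mL x y) ∈ harmSpan := by
  induction hx using y_ind with
  | h0 => simp
  | ha a b _ _ h1 h2 => simpa using add_mem h1 h2
  | hs c a _ h => simpa using Submodule.smul_mem _ c h
  | hw k u =>
    induction hy using y_ind with
    | h0 => simp
    | ha a b _ _ h1 h2 => simpa using add_mem h1 h2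
    | hs c a _ h => simpa using Submodule.smul_mem _ c h
    | hw l v =>
      rw [cL_W, cL_W]
      have h := Iw_Y (mL_y k u l v)
      rw [Dd_mul, Y_W, Y_W, map_smul, map_smul, LinearMap.smul_apply, ← add_smul, map_smul] at h
      have hne : ((wt (k :: u) : ℚ) + wt (l :: v)) ≠ 0 := by
        have : wt (k :: u) + wt (l :: v) ≠ 0 := by simp [wt]
        exact_mod_cast this
      have h2 : Iw (mL (W (k :: u)) (W (l :: v))) =
          ((wt (k :: u) : ℚ) + wt (l :: v))⁻¹ • mL (W (k :: u)) (W (l :: v)) := by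
        rw [eq_inv_smul_iff₀ hne]; exact h
      rw [h2]
      exact Submodule.smul_mem _ _ (mL_P (W_cons_mem _ _) (W_cons_mem _ _))

theorem Iw_P {x} (hx : x ∈ harmSpan) : Iw x ∈ harmSpan := by
  refine Submodule.span_induction ?_ (by simp) (fun a b _ _ h1 h2 => by simpa using add_mem h1 h2)
    (fun c a _ h => by simpa using Submodule.smul_mem _ c h) hx
  rintro x ⟨u, hu, v, hv, rfl⟩
  rw [harm_eq]
  exact Iw_mul hu hv

theorem main {x} (hx : x ∈ yH1) (h : Phi 1 x = 0) : x ∈ harmSpan := by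
  have h1 := Phi_P 0 _ (Dd_P 1 hx h)
  have h2 := congrArg (fun f => f x) Phi_comm
  simp only [LinearMap.comp_apply, LinearMap.add_apply, h1, h, add_zero] at h2
  have hy : Phi 0 x ∈ yH1 := by
    refine map_y (Phi 0) (fun k w => ?_) hx
    have hP : harmSpan ≤ yH1 := by
      refine Submodule.span_le.2 ?_
      rintro x ⟨u, hu, v, hv, rfl⟩
      rw [harm_eq]
      induction hu using y_ind with
      | h0 => simp
      | ha a b _ _ h1 h2 => simpa using add_mem h1 h2
      | hs c a _ h => simpa using Submodule.smul_mem _ c h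
      | hw k u =>
        induction hv using y_ind with
        | h0 => simp
        | ha a b _ _ h1 h2 => simpa using add_mem h1 h2
        | hs c a _ h => simpa using Submodule.smul_mem _ c h
        | hw l v => rw [cL_W, cL_W]; exact mL_y _ _ _ _
    have hm := map_y _ anti_y (Dd_y 0 k w)
    have := id_conv_P (anti ∘ₗ Dd 0) (fun k w => map_y _ anti_y (Dd_y 0 k w)) (W_cons_mem k w)
    have := add_mem (hP this) hm
    simpa [Phi] using this
  have h3 := D_inj hy h2.symm
  have h4 := Iw_P (Dd_P 0 hx h3)
  rwa [Iw_Y hx] at h4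

/-! Link with the given definitions -/

theorem sig0 (w) : sigW 0 w = W w := by
  induction w with
  | nil => simp [sigW]
  | cons k w ih =>
    have p0 : pplus k 0 = k := PNat.eq (by simp [pplus])
    rw [sigW]; simp [ih, p0, consL_eq, cL_W]

theorem sig1 (w) : sigW 1 w = Dd 1 (W w) := by
  induction w with
  | nil => simp [sigW]
  | cons k w ih =>
    have p0 : pplus k 0 = k := PNat.eq (by simp [pplus])
    rw [sigW, ← cL_W, Dd_cons]
    simp [Finset.sum_range_succ, ih, p0, consL_eq, sig0, add_comm]

noncomputable def rv : H1 →ₗ[ℚ] H1 := lin (fun w => W w.reverse)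
noncomputable def snoc (k : ℕ+) : H1 →ₗ[ℚ] H1 := lin (fun w => W (w ++ [k]))

theorem snoc_cons (k l h) : snoc k (cL l h) = cL l (snoc k h) := by
  have : snoc k ∘ₗ cL l = cL l ∘ₗ snoc k := lext fun w => by simp [cL_W, snoc]
  exact congrArg (fun f => f h) this

theorem rv_cons (k h) : rv (cL k h) = snoc k (rv h) := by
  have : rv ∘ₗ cL k = snoc k ∘ₗ rv := lext fun w => by simp [cL_W, snoc, rv]
  exact congrArg (fun f => f h) this

theorem Dd_snoc (e k h) : Dd e (snoc k h) =
    ((k : ℕ) : ℚ) • snoc (pplus k e) h + snoc k (Dd e h) := by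
  have : Dd e ∘ₗ snoc k = ((k : ℕ) : ℚ) • snoc (pplus k e) + snoc k ∘ₗ Dd e := lext fun w => by
    induction w with
    | nil =>
      have h1 : ∀ k, snoc k (W []) = cL k (W []) := fun k => by simp [snoc, cL_W]
      simp [h1, Dd_cons]
    | cons l w ih =>
      simp only [LinearMap.comp_apply, LinearMap.add_apply, LinearMap.smul_apply] at ih ⊢
      simp only [← cL_W, snoc_cons, Dd_cons, ih, map_add, map_smul]
      abel
  exact congrArg (fun f => f h) this

theorem rv_Dd (e w) : Dd e (rv (W w)) = rv (Dd e (W w)) := by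
  induction w with
  | nil => simp [rv]
  | cons k w ih => simp only [← cL_W, rv_cons, Dd_snoc, Dd_cons, ih, map_add, map_smul]

theorem Stt_eq (x) : Stt (rv x) = anti x := by
  have h1 : ∀ x, Stt x = lin SttW x := fun x => (lin_apply _ _).symm
  have : lin SttW ∘ₗ rv = anti := lext fun w => by simp [rv, anti, AF, SttW]
  rw [h1]
  exact congrArg (fun f => f x) this

theorem psiW_eq (w) : psiW w = Phi 1 (W w) := by
  rw [Phi, convW_sum, Finset.sum_range_succ, psiW]
  simp only [List.drop_length, LinearMap.comp_apply, Dd_nil, map_zero, add_zero]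
  refine Finset.sum_congr rfl fun i _ => ?_
  have : W (w.drop i).reverse = rv (W (w.drop i)) := by simp [rv]
  rw [harm_eq, sig1, this, rv_Dd, Stt_eq]; rfl

theorem psi_eq (x) : psi x = Phi 1 x := by
  have h1 : psi x = lin psiW x := (lin_apply _ _).symm
  rw [h1]
  have h2 : lin psiW = Phi 1 := lext fun w => by rw [lin_W, psiW_eq]
  rw [h2]

end PsiKer

/-- Lemma 10: `ker ψ ⊆ yH ∗ yH`. -/
theorem psi_kernel_subset (w : H1) (hw : w ∈ yH1) (h0 : psi w = 0) : w ∈ harmSpan := by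
  exact PsiKer.main hw (by rw [← PsiKer.psi_eq, h0])
end
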